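/- arXiv:1511.00648 — 2 statements merged into one kernel-verified Lean document; each statement's English description precedes it below -/
import Mathlib

section
/- For every integer d ≥ 1 and every p₀ ∈ (0, 1/2] there exists a constant C > 0 depending only on d and p₀ such that the following holds for all sufficiently large n (with the threshold depending only on d, p₀ and t). Let t ≥ 1 be a real number, let p ∈ [p₀, 1−p₀] with pn an integer, and let f be a multilinear polynomial of degree at most d on n variables all of whose coefficients f̂(S) are integer multiples of 2^{−d}. Then at least one of the following holds: (i) there exists α ∈ {−1,1}^n with Σ_{i=1}^n α_i = (1−2p)n and f(α) ≥ E_{D_p}[f] + t; or (ii) there exists a multilinear polynomial h of degree at most d−1 such that the polynomial f − (Σ_{i=1}^n x_i − (1−2p)n)·h, expanded as a multilinear polynomial over {−1,1}^n, has at most C·t² active variables. -/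
open Finset

/-- Evaluation of a multilinear polynomial given its coefficients. -/
noncomputable def evalML {n : ℕ} (c : Finset (Fin n) → ℝ) (x : Fin n → ℝ) : ℝ :=
  ∑ S : Finset (Fin n), c S * ∏ i ∈ S, x i

/-- The ±1 assignment corresponding to a Boolean assignment. -/
def signs {n : ℕ} (σ : Fin n → Bool) : Fin n → ℝ := fun i => if σ i then 1 else -1

/-- The (integer) sum of the ±1 values of an assignment. -/
def intSum {n : ℕ} (σ : Fin n → Bool) : ℤ := ∑ i, (if σ i then (1 : ℤ) else -1)

/-- The set of assignments satisfying `∑ i x i = (1-2p) n`, where `k = p n` is the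
number of `-1` coordinates, so that the constraint reads `∑ i x i = n - 2 k`. -/
def cardSet (n k : ℕ) : Finset (Fin n → Bool) :=
  Finset.univ.filter fun σ => intSum σ = (n : ℤ) - 2 * k

/-- Expectation of `g` over the uniform distribution on `A`. -/
noncomputable def expOver {n : ℕ} (A : Finset (Fin n → Bool)) (g : (Fin n → Bool) → ℝ) : ℝ :=
  (∑ σ ∈ A, g σ) / A.card

/-- Coefficient at `T` of the multilinear expansion of `(∑ i, x i) * h` (using `x i ^ 2 = 1`). -/
noncomputable def mulSum {n : ℕ} (h : Finset (Fin n) → ℝ) (T : Finset (Fin n)) : ℝ :=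
  ∑ i : Fin n, h (symmDiff T {i})

/-- The character `x ↦ ∏ i ∈ S, x i` at the sign vector which is `-1` exactly on `A`. -/
noncomputable def chi {ι : Type*} [Fintype ι] [DecidableEq ι] (S A : Finset ι) : ℝ :=
  ∏ i, if i ∈ S ∧ i ∈ A then -1 else 1

/-- The value of the multilinear polynomial with coefficients `c` at the sign vector which is
`-1` exactly on `A`. -/
noncomputable def ev {ι : Type*} [Fintype ι] [DecidableEq ι] (c : Finset ι → ℝ)
    (A : Finset ι) : ℝ :=
  ∑ S, c S * chi S A

section Characters

variable {ι : Type*} [Fintype ι] [DecidableEq ι]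

theorem chi_comm (S A : Finset ι) : chi S A = chi A S := by
  simp only [chi, and_comm]

theorem chi_symmDiff_left (S T A : Finset ι) : chi (symmDiff S T) A = chi S A * chi T A := by
  simp only [chi, ← Finset.prod_mul_distrib]
  refine Finset.prod_congr rfl fun i _ => ?_
  by_cases h1 : i ∈ S <;> by_cases h2 : i ∈ T <;> by_cases h3 : i ∈ A <;>
    simp [Finset.mem_symmDiff, h1, h2, h3]

theorem chi_symmDiff_right (S A B : Finset ι) : chi S (symmDiff A B) = chi S A * chi S B := by
  rw [chi_comm, chi_symmDiff_left, chi_comm A, chi_comm B]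

theorem chi_singleton_left (i : ι) (A : Finset ι) : chi {i} A = if i ∈ A then -1 else 1 := by
  unfold chi
  rw [Finset.prod_eq_single i]
  · simp
  · intro j _ hj
    simp [hj]
  · simp

theorem chi_empty_left (A : Finset ι) : chi ∅ A = 1 := by simp [chi]

theorem chi_map (π : Equiv.Perm ι) (S A : Finset ι) :
    chi (S.map π.toEmbedding) (A.map π.toEmbedding) = chi S A := by
  unfold chi
  rw [← Equiv.prod_comp π]
  simp

theorem chi_eq_prod (S A : Finset ι) : chi S A = ∏ i ∈ S, if i ∈ A then -1 else 1 := by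
  unfold chi
  rw [← Finset.prod_subset (Finset.subset_univ S)]
  · exact Finset.prod_congr rfl fun i hi => by simp [hi]
  · intro i _ hi
    simp [hi]

theorem chi_mul_self (S A : Finset ι) : chi S A * chi S A = 1 := by
  rw [← chi_symmDiff_left, symmDiff_self]
  exact chi_empty_left A

theorem sum_chi_eq_zero {S : Finset ι} (hS : S ≠ ∅) : ∑ A, chi S A = 0 := by
  obtain ⟨i, hi⟩ := Finset.nonempty_iff_ne_empty.mpr hS
  have h : ∑ A, chi S A = ∑ A, chi S (symmDiff A {i}) :=
    (Equiv.sum_comp (Function.Involutive.toPerm (fun A : Finset ι => symmDiff A {i})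
      (fun A => symmDiff_symmDiff_cancel_right _ _)) (fun A => chi S A)).symm
  simp only [chi_symmDiff_right, chi_comm S {i}, chi_singleton_left, hi, if_true] at h
  rw [← Finset.sum_mul] at h
  linarith

theorem sum_chi_mul_chi (S T : Finset ι) :
    ∑ A, chi S A * chi T A = if S = T then (2 : ℝ) ^ Fintype.card ι else 0 := by
  simp only [← chi_symmDiff_left]
  split_ifs with h
  · subst h
    simp [chi]
  · exact sum_chi_eq_zero fun h' => h (symmDiff_eq_bot.mp h')

/-- Parseval's identity on the cube. -/
theorem sum_ev_sq (c : Finset ι → ℝ) :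
    ∑ A, ev c A ^ 2 = 2 ^ Fintype.card ι * ∑ S, c S ^ 2 := by
  have h : ∀ A : Finset ι, ev c A ^ 2 = ∑ S, ∑ T, c S * c T * (chi S A * chi T A) := by
    intro A
    rw [ev, sq, Finset.sum_mul_sum]
    exact Finset.sum_congr rfl fun S _ => Finset.sum_congr rfl fun T _ => by ring
  simp only [h]
  rw [Finset.sum_comm, Finset.mul_sum]
  refine Finset.sum_congr rfl fun S _ => ?_
  rw [Finset.sum_comm]
  simp only [← Finset.mul_sum, sum_chi_mul_chi]
  simp
  ring

theorem sum_eq_zero_of_odd (i : ι) (F : Finset ι → ℝ) (hF : ∀ A, F (symmDiff A {i}) = -F A) :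
    ∑ A, F A = 0 := by
  have h : ∑ A, F (symmDiff A {i}) = ∑ A, F A :=
    Equiv.sum_comp (Function.Involutive.toPerm (fun A : Finset ι => symmDiff A {i})
      (fun A => symmDiff_symmDiff_cancel_right _ _)) F
  simp only [hF, Finset.sum_neg_distrib] at h
  linarith

/-- Bonami's lemma: the fourth moment of a low degree polynomial on the cube is controlled by
its second moment. -/
theorem sum_pow_four_le (U : Finset ι) : ∀ (d : ℕ) (c : Finset ι → ℝ),
    (∀ S, S ⊆ U → d < S.card → c S = 0) →
    2 ^ Fintype.card ι * ∑ A, (∑ S ∈ U.powerset, c S * chi S A) ^ 4 ≤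
      9 ^ d * (∑ A, (∑ S ∈ U.powerset, c S * chi S A) ^ 2) ^ 2 := by
  induction U using Finset.induction_on with
  | empty =>
    intro d c _
    have h1 : (1 : ℝ) ≤ 9 ^ d := one_le_pow₀ (by norm_num)
    simp only [Finset.powerset_empty, Finset.sum_singleton, chi_empty_left, mul_one,
      Finset.sum_const, Finset.card_univ, Fintype.card_finset, nsmul_eq_mul]
    push_cast
    have h2 : 0 ≤ ((2 : ℝ) ^ Fintype.card ι * c ∅ ^ 2) ^ 2 := by positivity
    nlinarith
  | insert i U hi ih =>
    intro d c hc
    set a : Finset ι → ℝ := fun A => ∑ S ∈ U.powerset, c S * chi S A with ha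
    set b : Finset ι → ℝ := fun A => ∑ S ∈ U.powerset, c (insert i S) * chi S A with hb
    have hsplit : ∀ A, ∑ S ∈ (insert i U).powerset, c S * chi S A = a A + chi {i} A * b A := by
      intro A
      rw [Finset.sum_powerset_insert hi, ha, hb, Finset.mul_sum]
      congr 1
      refine Finset.sum_congr rfl fun S hS => ?_
      have hiS : i ∉ S := fun h => hi (Finset.mem_powerset.mp hS h)
      have : insert i S = symmDiff {i} S := by
        ext j
        simp only [Finset.mem_insert, Finset.mem_symmDiff, Finset.mem_singleton]
        by_cases hj : j = i
        · subst hj; simp [hiS]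
        · simp [hj]
      rw [this, chi_symmDiff_left]
      ring
    have hodd : ∀ S ∈ U.powerset, ∀ A, chi S (symmDiff A {i}) = chi S A := by
      intro S hS A
      have hiS : i ∉ S := fun h => hi (Finset.mem_powerset.mp hS h)
      rw [chi_symmDiff_right, chi_comm S {i}, chi_singleton_left]
      simp [hiS]
    have ha' : ∀ A, a (symmDiff A {i}) = a A := fun A =>
      Finset.sum_congr rfl fun S hS => by rw [hodd S hS]
    have hb' : ∀ A, b (symmDiff A {i}) = b A := fun A =>
      Finset.sum_congr rfl fun S hS => by rw [hodd S hS]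
    have hx' : ∀ A, chi {i} (symmDiff A {i}) = -chi {i} A := by
      intro A
      rw [chi_symmDiff_right]
      simp [chi_singleton_left]
    have hx2 : ∀ A, chi {i} A ^ 2 = 1 := fun A => by rw [sq, chi_mul_self]
    have h2 : ∑ A, (a A + chi {i} A * b A) ^ 2 = ∑ A, a A ^ 2 + ∑ A, b A ^ 2 := by
      have h0 : ∑ A, chi {i} A * (-2 * (a A * b A)) = 0 := by
        refine sum_eq_zero_of_odd i _ fun A => ?_
        rw [ha', hb', hx']; ring
      rw [← Finset.sum_add_distrib, ← add_zero (∑ A, _), ← h0, ← Finset.sum_add_distrib]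
      refine Finset.sum_congr rfl fun A _ => ?_
      linear_combination (b A ^ 2) * hx2 A
    have h4 : ∑ A, (a A + chi {i} A * b A) ^ 4 =
        ∑ A, a A ^ 4 + 6 * ∑ A, a A ^ 2 * b A ^ 2 + ∑ A, b A ^ 4 := by
      have h0 : ∑ A, chi {i} A * (-4 * (a A ^ 3 * b A) - 4 * (a A * b A ^ 3)) = 0 := by
        refine sum_eq_zero_of_odd i _ fun A => ?_
        rw [ha', hb', hx']; ring
      rw [Finset.mul_sum, ← Finset.sum_add_distrib, ← Finset.sum_add_distrib,
        ← add_zero (∑ A, _), ← h0, ← Finset.sum_add_distrib]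
      refine Finset.sum_congr rfl fun A _ => ?_
      linear_combination (6 * a A ^ 2 * b A ^ 2 + 4 * a A * b A ^ 3 * chi {i} A +
        b A ^ 4 * (chi {i} A ^ 2 + 1)) * hx2 A
    simp only [hsplit, h2, h4]
    have iha := ih d c fun S hS => hc S (hS.trans (Finset.subset_insert i U))
    change _ * ∑ A, a A ^ 4 ≤ _ * (∑ A, a A ^ 2) ^ 2 at iha
    have hCS : (∑ A, a A ^ 2 * b A ^ 2) ^ 2 ≤ (∑ A, a A ^ 4) * ∑ A, b A ^ 4 := by
      refine (Finset.sum_mul_sq_le_sq_mul_sq _ _ _).trans ?_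
      simp only [← pow_mul, Nat.reduceMul, le_refl]
    cases d with
    | zero =>
      have hb0 : ∀ A, b A = 0 := fun A => Finset.sum_eq_zero fun S hS => by
        rw [hc (insert i S) (Finset.insert_subset_insert i (Finset.mem_powerset.mp hS))
          (by simp), zero_mul]
      simpa [hb0] using iha
    | succ d =>
      have ihb := ih d (fun S => c (insert i S)) fun S hS hd =>
        hc _ (Finset.insert_subset_insert i hS) (by
          rw [Finset.card_insert_of_notMem fun h => hi (hS h)]; omega)
      change _ * ∑ A, b A ^ 4 ≤ _ * (∑ A, b A ^ 2) ^ 2 at ihb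
      set M : ℝ := 2 ^ Fintype.card ι
      have hM : 0 < M := by positivity
      have hK : (0 : ℝ) < 9 ^ d := by positivity
      rw [pow_succ] at iha ⊢
      set K : ℝ := 9 ^ d
      have hA2 : 0 ≤ ∑ A, a A ^ 2 := Finset.sum_nonneg fun A _ => by positivity
      have hB2 : 0 ≤ ∑ A, b A ^ 2 := Finset.sum_nonneg fun A _ => by positivity
      have hA4 : 0 ≤ ∑ A, a A ^ 4 := Finset.sum_nonneg fun A _ => by positivity
      have hB4 : 0 ≤ ∑ A, b A ^ 4 := Finset.sum_nonneg fun A _ => by positivity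
      have hAB : 0 ≤ ∑ A, a A ^ 2 * b A ^ 2 := Finset.sum_nonneg fun A _ => by positivity
      generalize (∑ A, a A ^ 2) = A2 at *
      generalize (∑ A, b A ^ 2) = B2 at *
      generalize (∑ A, a A ^ 4) = A4 at *
      generalize (∑ A, b A ^ 4) = B4 at *
      generalize (∑ A, a A ^ 2 * b A ^ 2) = AB at *
      have hkey : M * AB ≤ 3 * K * (A2 * B2) := by
        refine le_of_sq_le_sq ?_ (by positivity)
        calc (M * AB) ^ 2 = M ^ 2 * AB ^ 2 := by ring
          _ ≤ M ^ 2 * (A4 * B4) := by gcongr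
          _ = (M * A4) * (M * B4) := by ring
          _ ≤ (K * 9 * A2 ^ 2) * (K * B2 ^ 2) := by gcongr
          _ = (3 * K * (A2 * B2)) ^ 2 := by ring
      nlinarith [mul_nonneg hK.le (sq_nonneg B2)]

theorem sum_ev_pow_four_le {d : ℕ} {c : Finset ι → ℝ} (hc : ∀ S, d < S.card → c S = 0) :
    2 ^ Fintype.card ι * ∑ A, ev c A ^ 4 ≤ 9 ^ d * (∑ A, ev c A ^ 2) ^ 2 := by
  simpa [ev] using sum_pow_four_le Finset.univ d c fun S _ => hc S

end Characters

section CubeBounds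

variable {ι : Type*} [Fintype ι] [DecidableEq ι]

theorem card_active_le {d : ℕ} {c : Finset ι → ℝ} (hc : ∀ S, d < S.card → c S = 0)
    (hint : ∀ S, S ≠ ∅ → ∃ m : ℤ, c S = m * (2 : ℝ) ^ (-(d : ℤ))) :
    ((univ.filter fun j => ∃ S, j ∈ S ∧ c S ≠ 0).card : ℝ) ≤ (4 ^ d) ^ 2 * ∑ S, c S ^ 2 := by
  set F : Finset (Finset ι) := univ.filter fun S => S ≠ ∅ ∧ c S ≠ 0
  have h1 : (univ.filter fun j => ∃ S, j ∈ S ∧ c S ≠ 0) ⊆ F.biUnion id := by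
    intro j hj
    obtain ⟨S, hjS, hS⟩ := (Finset.mem_filter.mp hj).2
    exact Finset.mem_biUnion.mpr ⟨S, Finset.mem_filter.mpr
      ⟨Finset.mem_univ _, Finset.ne_empty_of_mem hjS, hS⟩, hjS⟩
  have h2 : (univ.filter fun j => ∃ S, j ∈ S ∧ c S ≠ 0).card ≤ ∑ S ∈ F, S.card :=
    (Finset.card_le_card h1).trans Finset.card_biUnion_le
  have h3 : ∀ S ∈ F, (S.card : ℝ) ≤ (4 ^ d) ^ 2 * c S ^ 2 := by
    intro S hS
    obtain ⟨-, hne, h0⟩ := Finset.mem_filter.mp hS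
    obtain ⟨m, hm⟩ := hint S hne
    have hd : S.card ≤ d := not_lt.mp fun h => h0 (hc S h)
    have hd4 : (S.card : ℝ) ≤ 4 ^ d := by
      exact_mod_cast hd.trans (Nat.lt_pow_self (by norm_num)).le
    have hm0 : m ≠ 0 := by
      rintro rfl
      simp [hm] at h0
    have hm1 : (1 : ℝ) ≤ (m : ℝ) ^ 2 := by
      exact_mod_cast (one_le_sq_iff_one_le_abs m).mpr (Int.one_le_abs hm0)
    have h4 : (4 : ℝ) ^ d * ((2 : ℝ) ^ (-(d : ℤ))) ^ 2 = 1 := by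
      rw [zpow_neg, zpow_natCast, inv_pow, ← pow_mul, mul_comm d 2, pow_mul]
      norm_num
    calc (S.card : ℝ) ≤ 4 ^ d * 1 := by simpa using hd4
      _ ≤ 4 ^ d * (m : ℝ) ^ 2 := by gcongr
      _ = 4 ^ d * (4 ^ d * ((2 : ℝ) ^ (-(d : ℤ))) ^ 2) * (m : ℝ) ^ 2 := by rw [h4, mul_one]
      _ = (4 ^ d) ^ 2 * c S ^ 2 := by rw [hm]; ring
  calc ((univ.filter fun j => ∃ S, j ∈ S ∧ c S ≠ 0).card : ℝ) ≤ ∑ S ∈ F, (S.card : ℝ) := by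
        exact_mod_cast h2
    _ ≤ ∑ S ∈ F, (4 ^ d) ^ 2 * c S ^ 2 := Finset.sum_le_sum h3
    _ ≤ ∑ S, (4 ^ d) ^ 2 * c S ^ 2 :=
        Finset.sum_le_sum_of_subset_of_nonneg (Finset.subset_univ _) fun _ _ _ => by positivity
    _ = _ := (Finset.mul_sum _ _ _).symm

/-- The first moment of a low degree polynomial on the cube is controlled by its Fourier
weight. -/
theorem sqrt_weight_le_sum_abs_ev {d : ℕ} {c : Finset ι → ℝ}
    (hc : ∀ S, d < S.card → c S = 0) :
    2 ^ Fintype.card ι * √(∑ S, c S ^ 2) ≤ 4 * 9 ^ d * ∑ A, |ev c A| := by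
  have h2 := sum_ev_sq c
  have h4 := sum_ev_pow_four_le hc
  have hV : 0 ≤ ∑ S, c S ^ 2 := Finset.sum_nonneg fun S _ => by positivity
  have hv2 := Real.sq_sqrt hV
  have hv := Real.sqrt_nonneg (∑ S, c S ^ 2)
  rw [h2] at h4
  rw [← hv2] at h2 h4
  generalize √(∑ S, c S ^ 2) = v at *
  have hK : (1 : ℝ) ≤ 9 ^ d := one_le_pow₀ (by norm_num)
  generalize (9 : ℝ) ^ d = K at *
  have hM : (0 : ℝ) < 2 ^ Fintype.card ι := by positivity
  generalize (2 : ℝ) ^ Fintype.card ι = M at *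
  have hT : 0 ≤ ∑ A, |ev c A| := Finset.sum_nonneg fun A _ => abs_nonneg _
  rcases hv.eq_or_lt with rfl | hv
  · rw [mul_zero]; positivity
  have hpt : ∀ y : ℝ, (2 * K * v) ^ 2 * y ^ 2 - y ^ 4 ≤ (2 * K * v) ^ 3 * |y| := by
    intro y
    have hL : 0 < 2 * K * v := by positivity
    generalize 2 * K * v = L at *
    rw [← sq_abs y, show y ^ 4 = |y| ^ 4 by rw [show 4 = 2 * 2 from rfl, pow_mul, pow_mul, sq_abs]]
    have hu := abs_nonneg y
    generalize |y| = u at *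
    have : u * L ^ 2 ≤ L ^ 3 + u ^ 3 := by
      rcases le_total u L with h | h
      · have : u * L ^ 2 ≤ L * L ^ 2 := by gcongr
        have : 0 ≤ u ^ 3 := by positivity
        nlinarith
      · have : u * L ^ 2 ≤ u * u ^ 2 := by gcongr
        have : 0 ≤ L ^ 3 := by positivity
        nlinarith
    nlinarith
  have hsum := Finset.sum_le_sum fun A (_ : A ∈ univ) => hpt (ev c A)
  rw [Finset.sum_sub_distrib, ← Finset.mul_sum, ← Finset.mul_sum, h2] at hsum
  generalize ∑ A, |ev c A| = T at *
  generalize ∑ A, ev c A ^ 4 = F at *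
  have hF : F ≤ K * M * v ^ 4 := by
    refine le_of_mul_le_mul_left ?_ hM
    linarith [show M * (K * M * v ^ 4) = K * (M * v ^ 2) ^ 2 by ring]
  have h5 : 3 * K ^ 2 * M * v ^ 4 ≤ 8 * K ^ 3 * v ^ 3 * T := by
    have : K * M * v ^ 4 ≤ K ^ 2 * M * v ^ 4 := by
      gcongr
      nlinarith
    nlinarith
  have h6 : (K ^ 2 * v ^ 3) * (3 * (M * v)) ≤ (K ^ 2 * v ^ 3) * (8 * K * T) := by nlinarith
  have h7 := le_of_mul_le_mul_left h6 (by positivity)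
  have : 0 ≤ K * T := by positivity
  nlinarith

theorem sqrt_card_active_le {d : ℕ} {c : Finset ι → ℝ} (hc : ∀ S, d < S.card → c S = 0)
    (hint : ∀ S, S ≠ ∅ → ∃ m : ℤ, c S = m * (2 : ℝ) ^ (-(d : ℤ))) :
    2 ^ Fintype.card ι * √((univ.filter fun j => ∃ S, j ∈ S ∧ c S ≠ 0).card : ℝ) ≤
      4 * 36 ^ d * ∑ A, |ev c A| := by
  have h1 := Real.sqrt_le_sqrt (card_active_le hc hint)
  rw [Real.sqrt_mul (by positivity), Real.sqrt_sq (by positivity)] at h1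
  have h2 := sqrt_weight_le_sum_abs_ev hc
  have h3 : (36 : ℝ) ^ d = 4 ^ d * 9 ^ d := by rw [← mul_pow]; norm_num
  calc _ ≤ 2 ^ Fintype.card ι * (4 ^ d * √(∑ S, c S ^ 2)) := by gcongr
    _ = 4 ^ d * (2 ^ Fintype.card ι * √(∑ S, c S ^ 2)) := by ring
    _ ≤ 4 ^ d * (4 * 9 ^ d * ∑ A, |ev c A|) := by gcongr
    _ = _ := by rw [h3]; ring

theorem exists_chi_comp {κ : Type*} [Fintype κ] [DecidableEq κ] {Φ : Finset κ → Finset ι}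
    (hΦ : ∀ i, ∃ (s : ℤ) (T : Finset κ), T.card ≤ 1 ∧
      ∀ Z, (if i ∈ Φ Z then (-1 : ℝ) else 1) = s * chi T Z) (S : Finset ι) :
    ∃ (s : ℤ) (T : Finset κ), T.card ≤ S.card ∧ ∀ Z, chi S (Φ Z) = s * chi T Z := by
  induction S using Finset.induction_on with
  | empty => exact ⟨1, ∅, le_rfl, fun Z => by simp [chi_empty_left]⟩
  | insert i S hi ih =>
    obtain ⟨s, T, hT, h⟩ := ih
    obtain ⟨s', T', hT', h'⟩ := hΦ i
    refine ⟨s' * s, symmDiff T' T, ?_, fun Z => ?_⟩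
    · rw [Finset.card_insert_of_notMem hi]
      have : symmDiff T' T ⊆ T' ∪ T := symmDiff_le_sup
      have := (Finset.card_le_card this).trans (Finset.card_union_le _ _)
      omega
    · rw [chi_eq_prod, Finset.prod_insert hi, ← chi_eq_prod, h, h', chi_symmDiff_left]
      push_cast
      ring

/-- Substituting signed variables and constants for the variables of a polynomial keeps its
degree and the granularity of its coefficients. -/
theorem exists_ev_comp {κ : Type*} [Fintype κ] [DecidableEq κ] {Φ : Finset κ → Finset ι}
    (hΦ : ∀ i, ∃ (s : ℤ) (T : Finset κ), T.card ≤ 1 ∧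
      ∀ Z, (if i ∈ Φ Z then (-1 : ℝ) else 1) = s * chi T Z)
    {d : ℕ} {c : Finset ι → ℝ} (hc : ∀ S, d < S.card → c S = 0)
    {q : ℝ} (hint : ∀ S, ∃ m : ℤ, c S = m * q) :
    ∃ c' : Finset κ → ℝ, (∀ T, d < T.card → c' T = 0) ∧ (∀ T, ∃ m : ℤ, c' T = m * q) ∧
      ∀ Z, ev c (Φ Z) = ev c' Z := by
  choose s T hT hs using exists_chi_comp hΦ
  choose m hm using hint
  refine ⟨fun T' => ∑ S, if T S = T' then c S * s S else 0, fun T' hT' => ?_, fun T' => ?_,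
    fun Z => ?_⟩
  · refine Finset.sum_eq_zero fun S _ => ?_
    split_ifs with h
    · rw [hc S (by have := hT S; rw [h] at this; omega), zero_mul]
    · rfl
  · refine ⟨∑ S, if T S = T' then m S * s S else 0, ?_⟩
    push_cast
    rw [Finset.sum_mul]
    refine Finset.sum_congr rfl fun S _ => ?_
    split_ifs
    · rw [hm]; ring
    · ring
  · simp only [ev, Finset.sum_mul]
    rw [Finset.sum_comm]
    refine Finset.sum_congr rfl fun S _ => ?_
    rw [hs]
    simp
    ring

/-- A polynomial on the cube which depends on `N` variables and has coefficients that are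
multiples of `2 ^ (-d)` has mean distance at least of order `√N` to every constant. -/
theorem sqrt_card_dependent_le {d : ℕ} {c : Finset ι → ℝ} (hc : ∀ S, d < S.card → c S = 0)
    (hint : ∀ S, ∃ m : ℤ, c S = m * (2 : ℝ) ^ (-(d : ℤ))) (a : ℝ) :
    2 ^ Fintype.card ι *
        √((univ.filter fun j => ∃ Z, ev c (symmDiff Z {j}) ≠ ev c Z).card : ℝ) ≤
      4 * 36 ^ d * ∑ Z, |ev c Z - a| := by
  set c' : Finset ι → ℝ := fun S => c S - if S = ∅ then a else 0 with hc'
  have hev : ∀ Z, ev c' Z = ev c Z - a := by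
    intro Z
    simp [ev, hc', sub_mul, Finset.sum_sub_distrib, chi_empty_left]
  have h := sqrt_card_active_le (d := d) (c := c')
    (fun S hS => by
      have : S ≠ ∅ := by rintro rfl; simp at hS
      simp [hc', this, hc S hS])
    (fun S hS => by simpa [hc', hS] using hint S)
  simp only [hev] at h
  refine le_trans ?_ h
  refine mul_le_mul_of_nonneg_left (Real.sqrt_le_sqrt ?_) (by positivity)
  refine Nat.cast_le.mpr (Finset.card_le_card (Finset.monotone_filter_right _ ?_))
  rintro j - ⟨Z, hZ⟩
  by_contra! hall
  refine hZ (sub_left_injective (b := a) ?_)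
  simp only [← hev]
  refine Finset.sum_congr rfl fun S _ => ?_
  by_cases hj : j ∈ S
  · rw [hall S hj, zero_mul, zero_mul]
  · rw [chi_symmDiff_right, chi_comm S {j}, chi_singleton_left, if_neg hj, mul_one]

end CubeBounds

/-- The polynomials of degree less than `d` in the variables from `U`. -/
def degLT {ι : Type*} (U : Finset ι) (d : ℕ) : Submodule ℝ (Finset ι → ℝ) where
  carrier := {h | ∀ S, h S ≠ 0 → S ⊆ U ∧ S.card < d}
  add_mem' {f g} hf hg S hS := by
    by_cases h : f S = 0
    · exact hg S fun h' => hS (by simp [h, h'])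
    · exact hf S h
  zero_mem' S hS := absurd rfl hS
  smul_mem' r f hf S hS := hf S fun h => hS (by simp [h])

/-- Multiplication by `∑ i ∈ U, x i - κ`. -/
def mulLinear {ι : Type*} [DecidableEq ι] (U : Finset ι) (κ : ℝ) :
    (Finset ι → ℝ) →ₗ[ℝ] (Finset ι → ℝ) where
  toFun h S := ∑ i ∈ U, h (symmDiff S {i}) - κ * h S
  map_add' f g := by
    funext S
    simp only [Pi.add_apply, Finset.sum_add_distrib]
    ring
  map_smul' r f := by
    funext S
    simp only [Pi.smul_apply, smul_eq_mul, RingHom.id_apply, ← Finset.mul_sum]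
    ring

/-- The multiples of `∑ i ∈ U, x i - κ` by polynomials of degree less than `d` in the variables
from `U`. -/
def sliceIdeal {ι : Type*} [DecidableEq ι] (U : Finset ι) (κ : ℝ) (d : ℕ) :
    Submodule ℝ (Finset ι → ℝ) :=
  (degLT U d).map (mulLinear U κ)

/-- The action of a permutation of the variables on polynomials. -/
def permAct {ι : Type*} (π : Equiv.Perm ι) : (Finset ι → ℝ) →ₗ[ℝ] (Finset ι → ℝ) :=
  LinearMap.funLeft ℝ ℝ fun S => S.map π.toEmbedding

section Ideal

variable {ι : Type*}

theorem permAct_apply (π : Equiv.Perm ι) (c : Finset ι → ℝ) (S : Finset ι) :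
    permAct π c S = c (S.map π.toEmbedding) := rfl

theorem permAct_mul (σ τ : Equiv.Perm ι) (c : Finset ι → ℝ) :
    permAct (σ * τ) c = permAct τ (permAct σ c) := by
  funext S
  simp only [permAct_apply, Finset.map_map]
  rfl

theorem permAct_one (c : Finset ι → ℝ) : permAct 1 c = c := by
  funext S
  rw [permAct_apply]
  congr 1
  exact Finset.map_refl

variable [DecidableEq ι]

theorem mulLinear_apply (U : Finset ι) (κ : ℝ) (h : Finset ι → ℝ) (S : Finset ι) :
    mulLinear U κ h S = ∑ i ∈ U, h (symmDiff S {i}) - κ * h S := rfl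

theorem map_symmDiff_singleton (π : Equiv.Perm ι) (S : Finset ι) (i : ι) :
    (symmDiff S {i}).map π.toEmbedding = symmDiff (S.map π.toEmbedding) {π i} := by
  ext j
  simp [Finset.mem_symmDiff, Equiv.symm_apply_eq]

theorem permAct_mem_sliceIdeal {U : Finset ι} {κ : ℝ} {d : ℕ} {π : Equiv.Perm ι}
    (hπ : U.map π.toEmbedding = U) {c : Finset ι → ℝ} (hc : c ∈ sliceIdeal U κ d) :
    permAct π c ∈ sliceIdeal U κ d := by
  obtain ⟨h, hh, rfl⟩ := hc
  refine ⟨permAct π h, fun S hS => ?_, ?_⟩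
  · obtain ⟨h1, h2⟩ := hh _ hS
    rw [Finset.card_map] at h2
    rw [← hπ, Finset.map_subset_map] at h1
    exact ⟨h1, h2⟩
  · funext S
    rw [permAct_apply, mulLinear_apply, mulLinear_apply]
    conv_rhs => rw [← hπ, Finset.sum_map]
    simp only [permAct_apply, map_symmDiff_singleton]
    rfl

theorem map_swap_eq_self {U : Finset ι} {a b : ι} (ha : a ∈ U) (hb : b ∈ U) :
    U.map (Equiv.swap a b).toEmbedding = U := by
  refine Finset.map_perm fun i hi => ?_
  rcases Equiv.swap_apply_ne_self_iff.mp hi with ⟨-, rfl | rfl⟩ <;> assumption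

theorem map_ofSubtype_eq_self {A U : Finset ι} (hAU : A ⊆ U) (τ : Equiv.Perm {i // i ∈ A}) :
    U.map (Equiv.Perm.ofSubtype τ).toEmbedding = U := by
  refine Finset.map_perm fun i hi => hAU ?_
  by_contra h
  exact hi (Equiv.Perm.ofSubtype_apply_of_not_mem τ h)

theorem permAct_ofSubtype_sub_mem {A U : Finset ι} (hAU : A ⊆ U) {κ : ℝ} {d : ℕ}
    {c : Finset ι → ℝ}
    (hsw : ∀ a ∈ A, ∀ b ∈ A, permAct (Equiv.swap a b) c - c ∈ sliceIdeal U κ d)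
    (τ : Equiv.Perm {i // i ∈ A}) :
    permAct (Equiv.Perm.ofSubtype τ) c - c ∈ sliceIdeal U κ d := by
  induction τ using Equiv.Perm.swap_induction_on with
  | one => simp [permAct_one]
  | swap_mul τ x y _ ih =>
    rw [map_mul, Equiv.Perm.ofSubtype_swap_eq, permAct_mul]
    have h1 := permAct_mem_sliceIdeal (map_ofSubtype_eq_self hAU τ) (hsw x x.2 y y.2)
    rw [map_sub] at h1
    simpa using add_mem h1 ih

/-- Averaging over the permutations of `A` makes a polynomial which is symmetric modulo the
slice ideal honestly symmetric. -/
theorem exists_symmetric {A U : Finset ι} (hAU : A ⊆ U) {κ : ℝ} {d : ℕ} {c : Finset ι → ℝ}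
    (hsw : ∀ a ∈ A, ∀ b ∈ A, permAct (Equiv.swap a b) c - c ∈ sliceIdeal U κ d) :
    ∃ c₁, c₁ - c ∈ sliceIdeal U κ d ∧
      (∀ a ∈ A, ∀ b ∈ A, permAct (Equiv.swap a b) c₁ = c₁) ∧
      ∀ S, c₁ S ≠ 0 → ∃ τ : Equiv.Perm {i // i ∈ A},
        c (S.map (Equiv.Perm.ofSubtype τ).toEmbedding) ≠ 0 := by
  set N : ℝ := ((Fintype.card (Equiv.Perm {i // i ∈ A}) : ℕ) : ℝ) with hN
  have hN0 : N ≠ 0 := by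
    rw [hN]
    exact_mod_cast Fintype.card_ne_zero
  refine ⟨N⁻¹ • ∑ τ : Equiv.Perm {i // i ∈ A}, permAct (Equiv.Perm.ofSubtype τ) c, ?_, ?_, ?_⟩
  · have : N⁻¹ • ∑ τ : Equiv.Perm {i // i ∈ A}, permAct (Equiv.Perm.ofSubtype τ) c - c =
        N⁻¹ • ∑ τ : Equiv.Perm {i // i ∈ A}, (permAct (Equiv.Perm.ofSubtype τ) c - c) := by
      rw [Finset.sum_sub_distrib, smul_sub, Finset.sum_const, Finset.card_univ,
        ← Nat.cast_smul_eq_nsmul ℝ, ← hN, inv_smul_smul₀ hN0]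
    rw [this]
    exact Submodule.smul_mem _ _ (Submodule.sum_mem _ fun τ _ =>
      permAct_ofSubtype_sub_mem hAU hsw τ)
  · intro a ha b hb
    rw [map_smul, map_sum]
    congr 1
    rw [← Equiv.sum_comp (Equiv.mulRight (Equiv.swap (⟨a, ha⟩ : {i // i ∈ A}) ⟨b, hb⟩))]
    refine Finset.sum_congr rfl fun τ _ => ?_
    rw [← permAct_mul, Equiv.coe_mulRight, map_mul, Equiv.Perm.ofSubtype_swap_eq, mul_assoc,
      Equiv.swap_mul_self, mul_one]
  · intro S hS
    by_contra! h
    refine hS ?_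
    simp [Finset.sum_apply, permAct_apply, h]

theorem card_map_ofSubtype_inter {A : Finset ι} (τ : Equiv.Perm {i // i ∈ A}) (S : Finset ι) :
    (S.map (Equiv.Perm.ofSubtype τ).toEmbedding ∩ A).card = (S ∩ A).card := by
  have h := Finset.map_inter (f := (Equiv.Perm.ofSubtype τ).toEmbedding) S A
  rw [map_ofSubtype_eq_self subset_rfl τ] at h
  rw [← h, Finset.card_map]

/-- One step of the elimination of the variables in `A`: the degree in these variables drops. -/
theorem exists_degree_drop {A U : Finset ι} (hAU : A ⊆ U) (κ : ℝ) {d j : ℕ} {c : Finset ι → ℝ}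
    (hc : c ∈ degLT U (d + 1)) (hj : ∀ S, c S ≠ 0 → (S ∩ A).card ≤ j + 1)
    (hsymm : ∀ a ∈ A, ∀ b ∈ A, permAct (Equiv.swap a b) c = c) :
    ∃ c', c' - c ∈ sliceIdeal U κ d ∧ ∀ S, c' S ≠ 0 → (S ∩ A).card ≤ j := by
  set h : Finset ι → ℝ := fun S => if (S ∩ A).card = j then
    ((j + 1 : ℕ) : ℝ)⁻¹ * (((A \ S).card : ℝ)⁻¹ * ∑ a ∈ A \ S, c (insert a S)) else 0 with hh
  have hdeg : h ∈ degLT U d := by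
    intro S hS
    have h1 : ∑ a ∈ A \ S, c (insert a S) ≠ 0 := by
      intro h0
      exact hS (by simp [hh, h0])
    obtain ⟨a, ha, hca⟩ := Finset.exists_ne_zero_of_sum_ne_zero h1
    obtain ⟨h2, h3⟩ := hc _ hca
    rw [Finset.card_insert_of_notMem (Finset.mem_sdiff.mp ha).2] at h3
    exact ⟨(Finset.subset_insert _ _).trans h2, by omega⟩
  have hval : ∀ T i, i ∈ T → i ∈ A → (T ∩ A).card = j + 1 →
      h (symmDiff T {i}) = ((j + 1 : ℕ) : ℝ)⁻¹ * c T := by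
    intro T i hiT hiA hT
    have h1 : symmDiff T {i} = T.erase i := by
      ext x
      by_cases hx : x = i
      · subst hx; simp [Finset.mem_symmDiff, hiT]
      · simp [Finset.mem_symmDiff, hx]
    have h2 : (T.erase i ∩ A).card = j := by
      rw [Finset.erase_inter, Finset.card_erase_of_mem (Finset.mem_inter.mpr ⟨hiT, hiA⟩), hT]
      rfl
    have h3 : ∀ a ∈ A \ T.erase i, c (insert a (T.erase i)) = c T := by
      intro a ha
      obtain ⟨haA, haT⟩ := Finset.mem_sdiff.mp ha
      by_cases hai : a = i
      · rw [hai, Finset.insert_erase hiT]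
      · have haT' : a ∉ T := fun h' => haT (Finset.mem_erase.mpr ⟨hai, h'⟩)
        conv_rhs => rw [← hsymm i hiA a haA, permAct_apply]
        congr 1
        ext x
        simp only [Finset.mem_insert, Finset.mem_erase, Finset.mem_map_equiv, Equiv.symm_swap]
        by_cases hxi : x = i
        · subst hxi
          simp [haT', Ne.symm hai]
        · by_cases hxa : x = a
          · subst hxa
            simp [hiT]
          · simp [hxi, hxa, Equiv.swap_apply_of_ne_of_ne]
    have h4 : ((A \ T.erase i).card : ℝ) ≠ 0 := by
      have : i ∈ A \ T.erase i := by simp [hiA]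
      exact_mod_cast Finset.card_ne_zero_of_mem this
    simp only [hh, h1, h2, if_true]
    rw [Finset.sum_congr rfl h3, Finset.sum_const, nsmul_eq_mul, inv_mul_cancel_left₀ h4]
  have hzero : ∀ T i, (T ∩ A).card ≥ j + 1 → ¬((T ∩ A).card = j + 1 ∧ i ∈ T ∧ i ∈ A) →
      h (symmDiff T {i}) = 0 := by
    intro T i hT hi
    have h1 : (symmDiff T {i} ∩ A).card ≠ j := by
      by_cases hiTA : i ∈ T ∧ i ∈ A
      · have h2 : (T ∩ A).erase i ⊆ symmDiff T {i} ∩ A := by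
          intro x
          simp only [Finset.mem_erase, Finset.mem_inter, Finset.mem_symmDiff,
            Finset.mem_singleton]
          tauto
        have h3 := Finset.card_le_card h2
        rw [Finset.card_erase_of_mem (Finset.mem_inter.mpr hiTA)] at h3
        have h4 : (T ∩ A).card ≠ j + 1 := fun h' => hi ⟨h', hiTA⟩
        omega
      · have h2 : T ∩ A ⊆ symmDiff T {i} ∩ A := by
          intro x hx
          have hxi : x ≠ i := by
            rintro rfl
            exact hiTA (Finset.mem_inter.mp hx)
          simp only [Finset.mem_inter, Finset.mem_symmDiff, Finset.mem_singleton] at hx ⊢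
          tauto
        have h3 := Finset.card_le_card h2
        omega
    simp [hh, h1]
  refine ⟨c - mulLinear U κ h, ?_, fun T hT => ?_⟩
  · rw [sub_sub_cancel_left]
    exact neg_mem ⟨h, hdeg, rfl⟩
  · by_contra! hlt
    refine hT ?_
    have hT0 : h T = 0 := by
      have : (T ∩ A).card ≠ j := by omega
      simp [hh, this]
    rw [Pi.sub_apply, mulLinear_apply, hT0, mul_zero, sub_zero]
    by_cases hTj : (T ∩ A).card = j + 1
    · have : ∀ i ∈ U, h (symmDiff T {i}) =
          if i ∈ T ∩ A then ((j + 1 : ℕ) : ℝ)⁻¹ * c T else 0 := by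
        intro i _
        split_ifs with hi
        · exact hval T i (Finset.mem_inter.mp hi).1 (Finset.mem_inter.mp hi).2 hTj
        · exact hzero T i hTj.ge fun h' => hi (Finset.mem_inter.mpr h'.2)
      rw [Finset.sum_congr rfl this, Finset.sum_ite_mem,
        Finset.inter_eq_right.mpr (Finset.inter_subset_right.trans hAU), Finset.sum_const, hTj,
        nsmul_eq_mul, mul_inv_cancel_left₀ (by positivity), sub_self]
    · rw [Finset.sum_eq_zero fun i _ => hzero T i hlt fun h' => hTj h'.1, sub_zero]
      by_contra hcT
      have := hj T hcT
      omega

theorem sliceIdeal_le_degLT (U : Finset ι) (κ : ℝ) (d : ℕ) :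
    sliceIdeal U κ d ≤ degLT U (d + 1) := by
  rintro _ ⟨h, hh, rfl⟩ S hS
  rw [mulLinear_apply] at hS
  by_cases h0 : h S = 0
  · rw [h0, mul_zero, sub_zero] at hS
    obtain ⟨i, hi, hSi⟩ := Finset.exists_ne_zero_of_sum_ne_zero hS
    obtain ⟨h1, h2⟩ := hh _ hSi
    have h3 : S ⊆ insert i (symmDiff S {i}) := by
      intro x hx
      by_cases hxi : x = i
      · simp [hxi]
      · simp [Finset.mem_symmDiff, hx, hxi]
    have h4 := (Finset.card_le_card h3).trans (Finset.card_insert_le _ _)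
    exact ⟨h3.trans (Finset.insert_subset hi h1), by omega⟩
  · exact ⟨(hh S h0).1, (hh S h0).2.trans (Nat.lt_succ_self d)⟩

/-- A polynomial which is symmetric in the variables from `A` modulo the slice ideal is congruent
to a polynomial which does not depend on these variables. -/
theorem exists_eliminate {A U : Finset ι} (hAU : A ⊆ U) (κ : ℝ) {d : ℕ} {c : Finset ι → ℝ}
    (hc : c ∈ degLT U (d + 1))
    (hsw : ∀ a ∈ A, ∀ b ∈ A, permAct (Equiv.swap a b) c - c ∈ sliceIdeal U κ d) :
    ∃ c', c' - c ∈ sliceIdeal U κ d ∧ ∀ S, c' S ≠ 0 → S ⊆ U \ A := by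
  suffices H : ∀ (j : ℕ) (c : Finset ι → ℝ), c ∈ degLT U (d + 1) →
      (∀ a ∈ A, ∀ b ∈ A, permAct (Equiv.swap a b) c - c ∈ sliceIdeal U κ d) →
      (∀ S, c S ≠ 0 → (S ∩ A).card ≤ j) →
      ∃ c', c' - c ∈ sliceIdeal U κ d ∧ ∀ S, c' S ≠ 0 → S ⊆ U \ A from
    H A.card c hc hsw fun S _ => Finset.card_le_card Finset.inter_subset_right
  intro j
  induction j with
  | zero =>
    intro c hc _ hj
    refine ⟨c, by simp, fun S hS i hi => ?_⟩
    have h1 := Finset.card_eq_zero.mp (Nat.le_zero.mp (hj S hS))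
    exact Finset.mem_sdiff.mpr ⟨(hc S hS).1 hi, fun hiA =>
      Finset.notMem_empty i (h1 ▸ Finset.mem_inter.mpr ⟨hi, hiA⟩)⟩
  | succ j ih =>
    intro c hc hsw hj
    obtain ⟨c₁, h1, h2, h3⟩ := exists_symmetric hAU hsw
    have hc₁ : c₁ ∈ degLT U (d + 1) := by
      simpa using add_mem (sliceIdeal_le_degLT U κ d h1) hc
    obtain ⟨c₂, h4, h5⟩ := exists_degree_drop hAU κ (j := j) hc₁ (fun S hS => by
      obtain ⟨τ, hτ⟩ := h3 S hS
      rw [← card_map_ofSubtype_inter τ]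
      exact hj _ hτ) h2
    have hc₂ : c₂ ∈ degLT U (d + 1) := by
      simpa using add_mem (sliceIdeal_le_degLT U κ d h4) hc₁
    obtain ⟨c₃, h6, h7⟩ := ih c₂ hc₂ (fun a ha b hb => by
      have h8 := permAct_mem_sliceIdeal (map_swap_eq_self (hAU ha) (hAU hb)) h4
      rw [map_sub, h2 a ha b hb] at h8
      simpa using sub_mem h8 h4) h5
    refine ⟨c₃, ?_, h7⟩
    simpa using add_mem (add_mem h6 h4) h1

end Ideal

section SwapDerivative

variable {ι : Type*} [DecidableEq ι]

theorem sum_sign {U A : Finset ι} (hA : A ⊆ U) :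
    ∑ i ∈ U, (if i ∈ A then (-1 : ℝ) else 1) = U.card - 2 * A.card := by
  have h : ∀ i ∈ U, (if i ∈ A then (-1 : ℝ) else 1) = 1 - 2 * (if i ∈ A then 1 else 0) := by
    intro i _
    split_ifs <;> norm_num
  rw [Finset.sum_congr rfl h, Finset.sum_sub_distrib, ← Finset.mul_sum, Finset.sum_ite_mem,
    Finset.inter_eq_right.mpr hA]
  simp

theorem map_swap_insert {a b : ι} {A : Finset ι} (ha : a ∉ A) (hb : b ∉ A) :
    (insert a A).map (Equiv.swap a b).toEmbedding = insert b A := by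
  rw [Finset.map_insert, Equiv.toEmbedding_apply, Equiv.swap_apply_left]
  congr 1
  ext x
  rw [Finset.mem_map_equiv, Equiv.symm_swap]
  by_cases hx : x = a
  · subst hx; simp [ha, hb]
  · by_cases hx' : x = b
    · subst hx'; simp [ha, hb]
    · rw [Equiv.swap_apply_of_ne_of_ne hx hx']

/-- The derivative of `c` in the direction of the transposition of `a` and `b`. -/
noncomputable def swapDeriv (a b : ι) (c : Finset ι → ℝ) (S : Finset ι) : ℝ :=
  if a ∈ S ∨ b ∈ S then 0 else c (insert a S) - c (insert b S)

theorem sub_permAct_swap (a b : ι) (hab : a ≠ b) (c : Finset ι → ℝ) (S : Finset ι) :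
    (c - permAct (Equiv.swap a b) c) S =
      swapDeriv a b c (symmDiff S {a}) - swapDeriv a b c (symmDiff S {b}) := by
  rw [Pi.sub_apply, permAct_apply]
  by_cases ha : a ∈ S <;> by_cases hb : b ∈ S
  · rw [map_swap_eq_self ha hb]
    simp [swapDeriv, Finset.mem_symmDiff, ha, hb, hab, hab.symm]
  · have h1 : insert a (symmDiff S {a}) = S := by
      ext x; by_cases hx : x = a
      · simp [hx, ha]
      · simp [Finset.mem_symmDiff, hx]
    have h2 : S.map (Equiv.swap a b).toEmbedding = insert b (symmDiff S {a}) := by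
      ext x
      simp only [Finset.mem_map_equiv, Equiv.symm_swap, Finset.mem_insert, Finset.mem_symmDiff,
        Finset.mem_singleton]
      by_cases hx : x = a
      · subst hx; simp [hb, ha, hab]
      · by_cases hx' : x = b
        · subst hx'; simp [ha]
        · simp [hx, hx', Equiv.swap_apply_of_ne_of_ne]
    simp [swapDeriv, Finset.mem_symmDiff, ha, hb, hab, hab.symm, h1, h2]
  · have h1 : insert b (symmDiff S {b}) = S := by
      ext x; by_cases hx : x = b
      · simp [hx, hb]
      · simp [Finset.mem_symmDiff, hx]
    have h2 : S.map (Equiv.swap a b).toEmbedding = insert a (symmDiff S {b}) := by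
      ext x
      simp only [Finset.mem_map_equiv, Equiv.symm_swap, Finset.mem_insert, Finset.mem_symmDiff,
        Finset.mem_singleton]
      by_cases hx : x = a
      · subst hx; simp [hb]
      · by_cases hx' : x = b
        · subst hx'; simp [ha, hb, hab.symm]
        · simp [hx, hx', Equiv.swap_apply_of_ne_of_ne]
    simp [swapDeriv, Finset.mem_symmDiff, ha, hb, hab, hab.symm, h1, h2]
  · have h2 : S.map (Equiv.swap a b).toEmbedding = S := by
      ext x
      simp only [Finset.mem_map_equiv, Equiv.symm_swap]
      by_cases hx : x = a
      · subst hx; simp [hb, ha]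
      · by_cases hx' : x = b
        · subst hx'; simp [ha, hb]
        · simp [hx, hx', Equiv.swap_apply_of_ne_of_ne]
    simp [swapDeriv, Finset.mem_symmDiff, ha, hb, hab, hab.symm, h2]

theorem swapDeriv_mem_degLT {U : Finset ι} {d : ℕ} {c : Finset ι → ℝ}
    (hc : c ∈ degLT U (d + 1)) {a b : ι} :
    swapDeriv a b c ∈ degLT ((U.erase a).erase b) d := by
  intro S hS
  unfold swapDeriv at hS
  split_ifs at hS with h
  · exact absurd rfl hS
  push Not at h
  have key : ∀ x, x ∉ S → c (insert x S) ≠ 0 → S ⊆ (U.erase a).erase b ∧ S.card < d := by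
    intro x hx hne
    obtain ⟨h1, h2⟩ := hc _ hne
    rw [Finset.card_insert_of_notMem hx] at h2
    refine ⟨?_, by omega⟩
    rw [Finset.subset_erase, Finset.subset_erase]
    exact ⟨⟨(Finset.subset_insert _ _).trans h1, h.1⟩, h.2⟩
  by_cases h0 : c (insert a S) = 0
  · exact key b h.2 fun h1 => hS (by rw [h0, h1, sub_self])
  · exact key a h.1 h0

theorem sub_permAct_swap_mem {U : Finset ι} {κ : ℝ} {d : ℕ} {c : Finset ι → ℝ} {a b : ι}
    (ha : a ∈ U) (hb : b ∈ U) (hab : a ≠ b)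
    (hQ : swapDeriv a b c ∈ sliceIdeal ((U.erase a).erase b) κ d) :
    c - permAct (Equiv.swap a b) c ∈ sliceIdeal U κ (d + 1) := by
  obtain ⟨h, hh, hhQ⟩ := hQ
  refine ⟨fun S => h (symmDiff S {a}) - h (symmDiff S {b}), fun S hS => ?_, ?_⟩
  · have key : ∀ x ∈ U, h (symmDiff S {x}) ≠ 0 → S ⊆ U ∧ S.card < d + 1 := by
      intro x hx hne
      obtain ⟨h1, h2⟩ := hh _ hne
      have h3 : S ⊆ insert x (symmDiff S {x}) := by
        intro y hy
        by_cases hyx : y = x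
        · simp [hyx]
        · simp [Finset.mem_symmDiff, hy, hyx]
      have h4 := (Finset.card_le_card h3).trans (Finset.card_insert_le _ _)
      exact ⟨h3.trans (Finset.insert_subset hx (h1.trans
        ((Finset.erase_subset _ _).trans (Finset.erase_subset _ _)))), by omega⟩
    by_cases h0 : h (symmDiff S {a}) = 0
    · exact key b hb fun h1 => hS (by simp only [h0, h1, sub_self])
    · exact key a ha h0
  · funext S
    rw [sub_permAct_swap a b hab, ← hhQ, mulLinear_apply, mulLinear_apply, mulLinear_apply]
    have hbU : b ∈ U.erase a := Finset.mem_erase.mpr ⟨hab.symm, hb⟩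
    rw [← Finset.add_sum_erase _ _ ha, ← Finset.add_sum_erase _ _ hbU]
    have hcomm : ∀ x, ∑ i ∈ (U.erase a).erase b, h (symmDiff (symmDiff S {i}) {x}) =
        ∑ i ∈ (U.erase a).erase b, h (symmDiff (symmDiff S {x}) {i}) := fun x =>
      Finset.sum_congr rfl fun i _ => by rw [symmDiff_right_comm]
    simp only [symmDiff_symmDiff_cancel_right, Finset.sum_sub_distrib]
    rw [hcomm a, hcomm b, symmDiff_right_comm S {a} {b}]
    ring

end SwapDerivative

section Slice

variable {ι : Type*} [Fintype ι] [DecidableEq ι]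

theorem ev_sub (c c' : Finset ι → ℝ) (A : Finset ι) : ev (c - c') A = ev c A - ev c' A := by
  simp [ev, sub_mul, Finset.sum_sub_distrib]

theorem ev_permAct (π : Equiv.Perm ι) (c : Finset ι → ℝ) (A : Finset ι) :
    ev (permAct π c) A = ev c (A.map π.toEmbedding) := by
  unfold ev
  conv_rhs => rw [← Equiv.sum_comp (Equiv.finsetCongr π)]
  refine Finset.sum_congr rfl fun S _ => ?_
  rw [permAct_apply, Equiv.finsetCongr_apply, chi_map]

theorem ev_shift (h : Finset ι → ℝ) (i : ι) (A : Finset ι) :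
    ev (fun S => h (symmDiff S {i})) A = (if i ∈ A then -1 else 1) * ev h A := by
  unfold ev
  conv_lhs => rw [← Equiv.sum_comp (Function.Involutive.toPerm
    (fun S : Finset ι => symmDiff S {i}) (fun S => symmDiff_symmDiff_cancel_right _ _))]
  rw [Finset.mul_sum]
  refine Finset.sum_congr rfl fun S _ => ?_
  change h (symmDiff (symmDiff S {i}) {i}) * chi (symmDiff S {i}) A = _ * (h S * chi S A)
  rw [symmDiff_symmDiff_cancel_right, chi_symmDiff_left, chi_singleton_left]
  ring

/-- Elements of the slice ideal vanish on the slice. -/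
theorem ev_eq_zero_of_mem_sliceIdeal {U : Finset ι} {k d : ℕ} {c : Finset ι → ℝ}
    (hc : c ∈ sliceIdeal U ((U.card : ℝ) - 2 * k) d) {A : Finset ι}
    (hA : A ∈ Finset.powersetCard k U) : ev c A = 0 := by
  obtain ⟨h, -, rfl⟩ := hc
  obtain ⟨hAU, hAk⟩ := Finset.mem_powersetCard.mp hA
  have h1 : ev (mulLinear U ((U.card : ℝ) - 2 * k) h) A =
      ∑ i ∈ U, ev (fun S => h (symmDiff S {i})) A - ((U.card : ℝ) - 2 * k) * ev h A := by
    simp only [ev, mulLinear_apply, sub_mul, Finset.sum_sub_distrib, Finset.sum_mul,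
      Finset.mul_sum]
    rw [Finset.sum_comm]
    simp only [mul_assoc]
  rw [h1]
  simp only [ev_shift]
  rw [← Finset.sum_mul, sum_sign hAU, hAk, sub_self]

theorem ev_congr_insert {c : Finset ι → ℝ} {a : ι} (hc : ∀ S, c S ≠ 0 → a ∉ S)
    (A : Finset ι) : ev c (insert a A) = ev c A := by
  refine Finset.sum_congr rfl fun S _ => ?_
  by_cases hS : c S = 0
  · simp [hS]
  · congr 1
    simp only [chi_eq_prod]
    refine Finset.prod_congr rfl fun i hi => ?_
    have : i ≠ a := by
      rintro rfl
      exact hc S hS hi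
    simp [this]

theorem ev_ne_zero_of_symmetric {U : Finset ι} {k d : ℕ} {c : Finset ι → ℝ}
    (hc : c ∈ degLT U (d + 1)) (hcI : c ∉ sliceIdeal U ((U.card : ℝ) - 2 * k) d)
    (hsw : ∀ a ∈ U, ∀ b ∈ U,
      permAct (Equiv.swap a b) c - c ∈ sliceIdeal U ((U.card : ℝ) - 2 * k) d)
    {A : Finset ι} (hA : A ∈ Finset.powersetCard k U) : ev c A ≠ 0 := by
  obtain ⟨c', h1, h2⟩ := exists_eliminate subset_rfl _ hc hsw
  have h3 : ∀ S, S ≠ ∅ → c' S = 0 := by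
    intro S hS
    by_contra h
    have := h2 S h
    rw [sdiff_self] at this
    exact hS (Finset.subset_empty.mp this)
  have h4 : ev c' A = c' ∅ := by
    unfold ev
    rw [Finset.sum_eq_single ∅ (fun S _ hS => by rw [h3 S hS, zero_mul]) (by simp),
      chi_empty_left, mul_one]
  have h5 := ev_eq_zero_of_mem_sliceIdeal h1 hA
  rw [ev_sub, h4, sub_eq_zero] at h5
  rw [← h5]
  intro h0
  have h6 : c' = 0 := by
    funext S
    by_cases hS : S = ∅
    · rw [hS, h0]; rfl
    · exact h3 S hS
  rw [h6, zero_sub, neg_mem_iff] at h1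
  exact hcI h1

/-- A polynomial of degree at most `d` outside the slice ideal is nonzero at a constant fraction
of the slice. -/
theorem choose_le_card_ev_ne_zero (d : ℕ) : ∀ (U : Finset ι) (k : ℕ) (c : Finset ι → ℝ),
    d ≤ k → c ∈ degLT U (d + 1) → c ∉ sliceIdeal U ((U.card : ℝ) - 2 * k) d →
    ∃ r ≤ d, (U.card - 2 * r).choose (k - r) ≤
      ((Finset.powersetCard k U).filter fun A => ev c A ≠ 0).card := by
  induction d with
  | zero =>
    intro U k c _ hc hcI
    refine ⟨0, le_rfl, ?_⟩
    rw [Finset.filter_true_of_mem, Finset.card_powersetCard]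
    · simp
    · intro A hA
      refine ev_ne_zero_of_symmetric hc hcI (fun a ha b hb => ?_) hA
      convert Submodule.zero_mem _
      funext S
      rw [Pi.sub_apply, permAct_apply, Pi.zero_apply]
      by_cases hS : S = ∅
      · simp [hS]
      · have h1 : ∀ T, T ≠ ∅ → c T = 0 := fun T hT => by
          by_contra h
          exact hT (Finset.card_eq_zero.mp (by have := (hc T h).2; omega))
        rw [h1 S hS, h1 _ (by simpa using hS), sub_zero]
  | succ d ih =>
    intro U k c hdk hc hcI
    by_cases hsw : ∀ a ∈ U, ∀ b ∈ U,
        permAct (Equiv.swap a b) c - c ∈ sliceIdeal U ((U.card : ℝ) - 2 * k) (d + 1)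
    · refine ⟨0, Nat.zero_le _, ?_⟩
      rw [Finset.filter_true_of_mem fun A hA => ev_ne_zero_of_symmetric hc hcI hsw hA,
        Finset.card_powersetCard]
      simp
    push Not at hsw
    obtain ⟨a, ha, b, hb, hnot⟩ := hsw
    have hab : a ≠ b := by
      rintro rfl
      refine hnot ?_
      rw [Equiv.swap_self]
      change permAct 1 c - c ∈ _
      rw [permAct_one, sub_self]
      exact zero_mem _
    have hbU : b ∈ U.erase a := Finset.mem_erase.mpr ⟨hab.symm, hb⟩
    set V := (U.erase a).erase b with hV
    have hVcard : V.card + 2 = U.card := by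
      have h1 := Finset.card_erase_add_one ha
      have h2 := Finset.card_erase_add_one hbU
      rw [← hV] at h2
      omega
    have haV : a ∉ V := by simp [hV]
    have hbV : b ∉ V := by simp [hV]
    have hQ := swapDeriv_mem_degLT (a := a) (b := b) hc
    have hκ : (V.card : ℝ) - 2 * (k - 1 : ℕ) = U.card - 2 * k := by
      rw [← hVcard, Nat.cast_sub (by omega)]
      push_cast
      ring
    have hQI : swapDeriv a b c ∉ sliceIdeal V ((V.card : ℝ) - 2 * (k - 1 : ℕ)) d := by
      rw [hκ]
      intro h
      refine hnot ?_
      rw [← neg_sub c]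
      exact neg_mem (sub_permAct_swap_mem ha hb hab h)
    obtain ⟨r, hr, hcard⟩ := ih V (k - 1) _ (by omega) hQ hQI
    refine ⟨r + 1, by omega, ?_⟩
    rw [show U.card - 2 * (r + 1) = V.card - 2 * r by omega,
      show k - (r + 1) = k - 1 - r by omega]
    refine hcard.trans (Finset.card_le_card_of_surjOn (fun A => (A.erase a).erase b) ?_)
    intro B hB
    obtain ⟨hB1, hB2⟩ := Finset.mem_filter.mp (Finset.mem_coe.mp hB)
    obtain ⟨hBV, hBk⟩ := Finset.mem_powersetCard.mp hB1
    have haB : a ∉ B := fun h => haV (hBV h)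
    have hbB : b ∉ B := fun h => hbV (hBV h)
    have hBU : B ⊆ U := hBV.trans ((Finset.erase_subset _ _).trans (Finset.erase_subset _ _))
    have hdiff : ev c (insert a B) - ev c (insert b B) = -2 * ev (swapDeriv a b c) B := by
      have h1 : ev (c - permAct (Equiv.swap a b) c) (insert a B) =
          ev (fun S => swapDeriv a b c (symmDiff S {a})) (insert a B) -
          ev (fun S => swapDeriv a b c (symmDiff S {b})) (insert a B) := by
        rw [← ev_sub]
        congr 1
        funext S
        rw [sub_permAct_swap a b hab]
        rfl
      rw [ev_sub, ev_permAct, map_swap_insert haB hbB, ev_shift, ev_shift,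
        ev_congr_insert fun S hS h => haV ((hQ S hS).1 h)] at h1
      rw [h1]
      simp [hab.symm, hbB]
      ring
    by_cases h0 : ev c (insert a B) = 0
    · refine ⟨insert b B, Finset.mem_coe.mpr (Finset.mem_filter.mpr
        ⟨Finset.mem_powersetCard.mpr ⟨Finset.insert_subset hb hBU, ?_⟩, fun h1 => hB2 ?_⟩), ?_⟩
      · rw [Finset.card_insert_of_notMem hbB]; omega
      · linarith
      · have h2 : a ∉ insert b B := by simp [hab, haB]
        simp only [Finset.erase_eq_of_notMem h2, Finset.erase_insert hbB]
    · refine ⟨insert a B, Finset.mem_coe.mpr (Finset.mem_filter.mpr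
        ⟨Finset.mem_powersetCard.mpr ⟨Finset.insert_subset ha hBU, ?_⟩, h0⟩), ?_⟩
      · rw [Finset.card_insert_of_notMem haB]; omega
      · simp only [Finset.erase_insert haB, Finset.erase_eq_of_notMem hbB]

end Slice

section Averaging

/-- Averaging over a finite group which acts transitively on `s`. -/
theorem card_mul_sum_group {G X : Type*} [Group G] [Fintype G] [MulAction G X] {s : Finset X}
    {x₀ : X} (htrans : ∀ x ∈ s, ∃ g : G, g • x₀ = x) (hinv : ∀ (g : G), ∀ x ∈ s, g • x ∈ s)
    (F : X → ℝ) :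
    (s.card : ℝ) * ∑ g : G, F (g • x₀) = Fintype.card G * ∑ x ∈ s, F x := by
  have h1 : ∀ x ∈ s, ∑ g : G, F (g • x) = ∑ g : G, F (g • x₀) := by
    intro x hx
    obtain ⟨h, rfl⟩ := htrans x hx
    simp only [smul_smul]
    exact Equiv.sum_comp (Equiv.mulRight h) fun g => F (g • x₀)
  have h2 : ∀ g : G, ∑ x ∈ s, F (g • x) = ∑ x ∈ s, F x := fun g =>
    Finset.sum_nbij' (fun x => g • x) (fun x => g⁻¹ • x) (hinv g) (hinv g⁻¹)
      (fun x _ => inv_smul_smul g x) (fun x _ => smul_inv_smul g x) fun _ _ => rfl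
  rw [← nsmul_eq_mul, ← Finset.sum_const, ← Finset.sum_congr rfl h1, Finset.sum_comm,
    Finset.sum_congr rfl fun g _ => h2 g, Finset.sum_const, nsmul_eq_mul, Finset.card_univ]

variable {ι : Type*} [DecidableEq ι]

open scoped Pointwise in
theorem smul_finset_eq_map (σ : Equiv.Perm ι) (A : Finset ι) :
    σ • A = A.map σ.toEmbedding := by
  rw [Finset.map_eq_image]
  rfl

variable [Fintype ι]

theorem exists_perm_map_eq {A B : Finset ι} (h : A.card = B.card) :
    ∃ σ : Equiv.Perm ι, A.map σ.toEmbedding = B := by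
  refine ⟨(Finset.equivOfCardEq h).extendSubtype, ?_⟩
  refine Finset.eq_of_subset_of_card_le (fun x hx => ?_) (by rw [Finset.card_map, h])
  obtain ⟨y, hy, rfl⟩ := Finset.mem_map.mp hx
  exact Equiv.extendSubtype_mem _ y hy

theorem exists_perm_map_eq_of_mem {A B : Finset ι} (h : A.card = B.card) {a b a' b' : ι}
    (ha : a ∈ A) (hb : b ∉ A) (ha' : a' ∈ B) (hb' : b' ∉ B) :
    ∃ σ : Equiv.Perm ι, A.map σ.toEmbedding = B ∧ σ a = a' ∧ σ b = b' := by
  obtain ⟨τ, hτ⟩ := exists_perm_map_eq h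
  have h1 : τ a ∈ B := by rw [← hτ]; simpa using ha
  have h2 : τ b ∉ B := by rw [← hτ]; simpa using hb
  have hab : ∀ x y, x ∈ B → y ∉ B → x ≠ y := fun x y hx hy hxy => hy (hxy ▸ hx)
  refine ⟨Equiv.swap (τ b) b' * (Equiv.swap (τ a) a' * τ), ?_, ?_, ?_⟩
  · ext x
    have h3 : ∀ x, Equiv.swap (τ a) a' x ∈ B ↔ x ∈ B := by
      intro x
      by_cases hx : x = τ a
      · simp [hx, h1, ha']
      · by_cases hx' : x = a'
        · simp [hx', h1, ha']
        · rw [Equiv.swap_apply_of_ne_of_ne hx hx']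
    have h4 : ∀ x, Equiv.swap (τ b) b' x ∈ B ↔ x ∈ B := by
      intro x
      by_cases hx : x = τ b
      · simp [hx, h2, hb']
      · by_cases hx' : x = b'
        · simp [hx', h2, hb']
        · rw [Equiv.swap_apply_of_ne_of_ne hx hx']
    have h5 : ∀ x, τ.symm x ∈ A ↔ x ∈ B := by
      intro x
      rw [← hτ, Finset.mem_map_equiv]
    rw [Finset.mem_map_equiv]
    change τ.symm ((Equiv.swap (τ a) a').symm ((Equiv.swap (τ b) b').symm x)) ∈ A ↔ _
    rw [h5, Equiv.symm_swap, Equiv.symm_swap, h3, h4]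
  · simp only [Equiv.Perm.mul_apply, Equiv.swap_apply_left]
    exact Equiv.swap_apply_of_ne_of_ne (hab _ _ ha' h2) (hab _ _ ha' hb')
  · simp only [Equiv.Perm.mul_apply]
    rw [Equiv.swap_apply_of_ne_of_ne (hab _ _ h1 h2).symm (hab _ _ ha' h2).symm,
      Equiv.swap_apply_left]

open scoped Pointwise in
theorem choose_mul_sum_perm {k : ℕ} {A₀ : Finset ι} (hA₀ : A₀.card = k) (F : Finset ι → ℝ) :
    ((Fintype.card ι).choose k : ℝ) * ∑ σ : Equiv.Perm ι, F (A₀.map σ.toEmbedding) =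
      Fintype.card (Equiv.Perm ι) * ∑ A ∈ Finset.powersetCard k univ, F A := by
  rw [← card_mul_sum_group (G := Equiv.Perm ι) (s := Finset.powersetCard k univ) (x₀ := A₀),
    Finset.card_powersetCard, Finset.card_univ]
  · simp only [smul_finset_eq_map]
  · intro A hA
    obtain ⟨σ, hσ⟩ := exists_perm_map_eq (hA₀.trans (Finset.mem_powersetCard.mp hA).2.symm)
    exact ⟨σ, by rw [smul_finset_eq_map, hσ]⟩
  · intro σ A hA
    rw [smul_finset_eq_map]
    simpa using hA

open scoped Pointwise in
theorem choose_mul_sum_perm_pair {k : ℕ} {A₀ : Finset ι} (hA₀ : A₀.card = k) {a₀ b₀ : ι}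
    (ha₀ : a₀ ∈ A₀) (hb₀ : b₀ ∉ A₀) (F : Finset ι → ι → ι → ℝ) :
    ((Fintype.card ι).choose k : ℝ) * k * (Fintype.card ι - k : ℕ) *
        ∑ σ : Equiv.Perm ι, F (A₀.map σ.toEmbedding) (σ a₀) (σ b₀) =
      Fintype.card (Equiv.Perm ι) *
        ∑ A ∈ Finset.powersetCard k univ, ∑ a, ∑ b, if a ∈ A ∧ b ∉ A then F A a b else 0 := by
  set s : Finset (Finset ι × ι × ι) := (Finset.powersetCard k univ ×ˢ univ ×ˢ univ).filter
    fun x => x.2.1 ∈ x.1 ∧ x.2.2 ∉ x.1 with hs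
  have hsum : ∀ G : Finset ι × ι × ι → ℝ, ∑ x ∈ s, G x =
      ∑ A ∈ Finset.powersetCard k univ, ∑ a, ∑ b, if a ∈ A ∧ b ∉ A then G (A, a, b) else 0 := by
    intro G
    rw [hs, Finset.sum_filter, Finset.sum_product]
    simp only [Finset.sum_product]
  have hcard : (s.card : ℝ) =
      ((Fintype.card ι).choose k : ℝ) * k * (Fintype.card ι - k : ℕ) := by
    rw [Finset.card_eq_sum_ones, Nat.cast_sum, hsum]
    have : ∀ A ∈ Finset.powersetCard k (univ : Finset ι),
        (∑ a, ∑ b, if a ∈ A ∧ b ∉ A then ((1 : ℕ) : ℝ) else 0) =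
          k * (Fintype.card ι - k : ℕ) := by
      intro A hA
      have hk := (Finset.mem_powersetCard.mp hA).2
      have h1 : ∀ a b, (if a ∈ A ∧ b ∉ A then ((1 : ℕ) : ℝ) else 0) =
          (if a ∈ A then 1 else 0) * (if b ∈ Aᶜ then 1 else 0) := by
        intro a b
        by_cases h : a ∈ A <;> by_cases h' : b ∈ A <;> simp [h, h']
      simp only [h1, ← Finset.mul_sum, ← Finset.sum_mul]
      rw [Finset.sum_boole, Finset.sum_boole, Finset.filter_univ_mem, Finset.filter_univ_mem,
        Finset.card_compl, hk]
    rw [Finset.sum_congr rfl this, Finset.sum_const, Finset.card_powersetCard, Finset.card_univ,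
      nsmul_eq_mul, mul_assoc]
  have h := card_mul_sum_group (G := Equiv.Perm ι) (s := s) (x₀ := (A₀, a₀, b₀)) ?_ ?_
    fun x => F x.1 x.2.1 x.2.2
  · rw [hsum, hcard] at h
    rw [← h]
    simp only [Prod.smul_fst, Prod.smul_snd, smul_finset_eq_map, Equiv.Perm.smul_def]
  · rintro ⟨A, a, b⟩ hx
    simp only [hs, Finset.mem_filter, Finset.mem_product, Finset.mem_powersetCard] at hx
    obtain ⟨σ, h1, h2, h3⟩ := exists_perm_map_eq_of_mem (hA₀.trans hx.1.1.2.symm) ha₀ hb₀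
      hx.2.1 hx.2.2
    exact ⟨σ, by simp only [Prod.smul_mk, smul_finset_eq_map, Equiv.Perm.smul_def, h1, h2, h3]⟩
  · rintro σ ⟨A, a, b⟩ hx
    simp only [hs, Finset.mem_filter, Finset.mem_product, Finset.mem_powersetCard] at hx
    simp only [hs, Finset.mem_filter, Finset.mem_product, Finset.mem_powersetCard,
      Prod.smul_mk, smul_finset_eq_map, Equiv.Perm.smul_def]
    simpa using hx

end Averaging

/-- The embedding of a cube into the slice: the first two blocks are paired up, and each pair
contributes exactly one element; all of the third block is contained in the set. -/
def subcube {ι : Type*} {m r : ℕ} (e : Fin m ⊕ Fin m ⊕ Fin r ↪ ι) (Z : Finset (Fin m)) :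
    Finset ι :=
  (Z.disjSum (Zᶜ.disjSum univ)).map e

section Subcube

variable {ι : Type*} {m r : ℕ} (e : Fin m ⊕ Fin m ⊕ Fin r ↪ ι) (Z : Finset (Fin m))

theorem card_subcube : (subcube e Z).card = m + r := by
  have h := Finset.card_add_card_compl Z
  rw [Fintype.card_fin] at h
  rw [subcube, Finset.card_map, Finset.card_disjSum, Finset.card_disjSum, Finset.card_univ,
    Fintype.card_fin]
  omega

theorem inl_mem_subcube (j : Fin m) : e (.inl j) ∈ subcube e Z ↔ j ∈ Z := by
  simp [subcube]

theorem inr_inl_mem_subcube (j : Fin m) : e (.inr (.inl j)) ∈ subcube e Z ↔ j ∉ Z := by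
  simp [subcube]

theorem inr_inr_mem_subcube (j : Fin r) : e (.inr (.inr j)) ∈ subcube e Z := by
  simp [subcube]

theorem map_subcube (σ : Equiv.Perm ι) :
    (subcube e Z).map σ.toEmbedding = subcube (e.trans σ.toEmbedding) Z := by
  rw [subcube, subcube, Finset.map_map]

theorem subcube_symmDiff [DecidableEq ι] (j : Fin m) :
    subcube e (symmDiff Z {j}) =
      (subcube e Z).map (Equiv.swap (e (.inl j)) (e (.inr (.inl j)))).toEmbedding := by
  ext i
  rw [Finset.mem_map_equiv, Equiv.symm_swap]
  by_cases hi : i ∈ Set.range e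
  · obtain ⟨x, rfl⟩ := hi
    rw [e.swap_apply]
    rcases x with x | x | x
    · by_cases hx : x = j
      · subst hx
        rw [Equiv.swap_apply_left, inl_mem_subcube, inr_inl_mem_subcube]
        simp [Finset.mem_symmDiff]
      · rw [Equiv.swap_apply_of_ne_of_ne (by simpa using hx) (by simp), inl_mem_subcube,
          inl_mem_subcube]
        simp [Finset.mem_symmDiff, hx]
    · by_cases hx : x = j
      · subst hx
        rw [Equiv.swap_apply_right, inl_mem_subcube, inr_inl_mem_subcube]
        simp [Finset.mem_symmDiff]
      · rw [Equiv.swap_apply_of_ne_of_ne (by simp) (by simpa using hx), inr_inl_mem_subcube,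
          inr_inl_mem_subcube]
        simp [Finset.mem_symmDiff, hx]
    · rw [Equiv.swap_apply_of_ne_of_ne (by simp) (by simp)]
      simp [inr_inr_mem_subcube]
  · have h1 : ∀ x, i ≠ e x := fun x hx => hi ⟨x, hx.symm⟩
    rw [Equiv.swap_apply_of_ne_of_ne (h1 _) (h1 _)]
    have h2 : ∀ Z, i ∉ subcube e Z := by
      intro Z h
      obtain ⟨x, -, hx⟩ := Finset.mem_map.mp h
      exact h1 x hx.symm
    simp [h2]

theorem exists_sign_subcube [DecidableEq ι] (i : ι) :
    ∃ (s : ℤ) (T : Finset (Fin m)), T.card ≤ 1 ∧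
      ∀ Z, (if i ∈ subcube e Z then (-1 : ℝ) else 1) = s * chi T Z := by
  by_cases hi : i ∈ Set.range e
  · obtain ⟨x | x | x, rfl⟩ := hi
    · exact ⟨1, {x}, by simp, fun Z => by simp [inl_mem_subcube, chi_singleton_left]⟩
    · refine ⟨-1, {x}, by simp, fun Z => ?_⟩
      by_cases hx : x ∈ Z <;> simp [inr_inl_mem_subcube, chi_singleton_left, hx]
    · exact ⟨-1, ∅, by simp, fun Z => by simp [inr_inr_mem_subcube, chi_empty_left]⟩
  · refine ⟨1, ∅, by simp, fun Z => ?_⟩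
    have h2 : i ∉ subcube e Z := by
      intro h
      obtain ⟨x, -, hx⟩ := Finset.mem_map.mp h
      exact hi ⟨x, hx⟩
    simp [h2, chi_empty_left]

end Subcube

section SwapClasses

theorem exists_large_class {ι : Type*} [Fintype ι] [DecidableEq ι] [Nonempty ι] {R : ι → ι → Prop}
    [DecidableRel R] (hR : Equivalence R) :
    ∃ A : Finset ι, (∀ a ∈ A, ∀ b ∈ A, R a b) ∧
      Fintype.card ι * Aᶜ.card ≤ ∑ a, ∑ b, if R a b then 0 else 1 := by
  obtain ⟨a₀, -, h⟩ := Finset.exists_max_image univ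
    (fun a => (univ.filter fun b => R a b).card) Finset.univ_nonempty
  refine ⟨univ.filter fun b => R a₀ b, fun a ha b hb => ?_, ?_⟩
  · exact hR.trans (hR.symm (Finset.mem_filter.mp ha).2) (Finset.mem_filter.mp hb).2
  · rw [← Finset.card_univ, ← smul_eq_mul]
    refine Finset.card_nsmul_le_sum _ _ _ fun a ha => ?_
    have h1 : (∑ b, if R a b then 0 else 1) = (univ.filter fun b => R a b)ᶜ.card := by
      rw [Finset.compl_filter, Finset.card_filter]
      exact Finset.sum_congr rfl fun b _ => by by_cases hb : R a b <;> simp [hb]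
    rw [h1, Finset.card_compl, Finset.card_compl]
    exact Nat.sub_le_sub_left (h a ha) _

variable {ι : Type*} [DecidableEq ι]

theorem map_swap_eq_self_of_iff {A : Finset ι} {a b : ι} (h : a ∈ A ↔ b ∈ A) :
    A.map (Equiv.swap a b).toEmbedding = A := by
  by_cases ha : a ∈ A
  · exact map_swap_eq_self ha (h.mp ha)
  · have hb : b ∉ A := fun hb => ha (h.mpr hb)
    ext x
    rw [Finset.mem_map_equiv, Equiv.symm_swap]
    by_cases hxa : x = a
    · simp [hxa, ha, hb]
    · by_cases hxb : x = b
      · simp [hxb, ha, hb]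
      · rw [Equiv.swap_apply_of_ne_of_ne hxa hxb]

variable [Fintype ι]

theorem permAct_mul_sub_mem {κ : ℝ} {d : ℕ} {c : Finset ι → ℝ} {σ τ : Equiv.Perm ι}
    (hσ : permAct σ c - c ∈ sliceIdeal univ κ d) (hτ : permAct τ c - c ∈ sliceIdeal univ κ d) :
    permAct (σ * τ) c - c ∈ sliceIdeal univ κ d := by
  have h := add_mem (permAct_mem_sliceIdeal (Finset.map_univ_equiv τ) hσ) hτ
  rwa [map_sub, sub_add_sub_cancel, ← permAct_mul] at h

theorem equivalence_swap (κ : ℝ) (d : ℕ) (c : Finset ι → ℝ) :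
    Equivalence fun a b => permAct (Equiv.swap a b) c - c ∈ sliceIdeal univ κ d := by
  refine ⟨fun a => ?_, fun {a b} h => ?_, fun {a b e} h h' => ?_⟩
  · rw [Equiv.swap_self]
    change permAct 1 c - c ∈ _
    rw [permAct_one, sub_self]
    exact zero_mem _
  · rwa [Equiv.swap_comm]
  · by_cases hab : a = b
    · rwa [hab]
    · by_cases hae : a = e
      · subst hae
        rw [Equiv.swap_self]
        change permAct 1 c - c ∈ _
        rw [permAct_one, sub_self]
        exact zero_mem _
      · rw [Equiv.swap_comm, ← Equiv.swap_mul_swap_mul_swap hab hae]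
        exact permAct_mul_sub_mem (permAct_mul_sub_mem h' h) h'

/-- The indicator of the event that exchanging `a` and `b` changes the value of the polynomial. -/
noncomputable def swapSens (c : Finset ι → ℝ) (A : Finset ι) (a b : ι) : ℝ :=
  if ev c (A.map (Equiv.swap a b).toEmbedding) ≠ ev c A then 1 else 0

theorem swapSens_nonneg (c : Finset ι → ℝ) (A : Finset ι) (a b : ι) : 0 ≤ swapSens c A a b := by
  rw [swapSens]
  split_ifs <;> norm_num

theorem swapSens_comm (c : Finset ι → ℝ) (A : Finset ι) (a b : ι) :
    swapSens c A a b = swapSens c A b a := by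
  rw [swapSens, swapSens, Equiv.swap_comm]

theorem sum_swapSens (c : Finset ι → ℝ) (A : Finset ι) :
    ∑ a, ∑ b, swapSens c A a b =
      2 * ∑ a, ∑ b, if a ∈ A ∧ b ∉ A then swapSens c A a b else 0 := by
  have h1 : ∀ a b, swapSens c A a b = (if a ∈ A ∧ b ∉ A then swapSens c A a b else 0) +
      if b ∈ A ∧ a ∉ A then swapSens c A b a else 0 := by
    intro a b
    by_cases h : a ∈ A ↔ b ∈ A
    · have : swapSens c A a b = 0 := by simp [swapSens, map_swap_eq_self_of_iff h]
      rw [if_neg (by tauto), if_neg (by tauto), this, add_zero]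
    · by_cases ha : a ∈ A
      · have hb : b ∉ A := by tauto
        simp [ha, hb]
      · have hb : b ∈ A := by tauto
        simp [ha, hb, swapSens_comm c A a b]
  simp only [fun a => Finset.sum_congr rfl fun b (_ : b ∈ univ) => h1 a b,
    Finset.sum_add_distrib]
  rw [two_mul]
  congr 1
  rw [Finset.sum_comm]

/-- Lower bound for the number of sensitive pairs in terms of the swap classes. -/
theorem exists_class_card_mul_le [Nonempty ι] {k d : ℕ} {γ : ℝ} (hγ : 0 ≤ γ) (hdk : d ≤ k)
    (hchoose : ∀ r ≤ d, γ * ((Fintype.card ι).choose k : ℝ) ≤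
      ((Fintype.card ι - 2 * r).choose (k - r) : ℝ))
    {c : Finset ι → ℝ} (hc : c ∈ degLT univ (d + 1)) :
    ∃ A : Finset ι, (∀ a ∈ A, ∀ b ∈ A, permAct (Equiv.swap a b) c - c ∈
        sliceIdeal univ ((Fintype.card ι : ℝ) - 2 * k) d) ∧
      γ * ((Fintype.card ι).choose k : ℝ) * (Fintype.card ι * Aᶜ.card) ≤
        2 * ∑ A ∈ Finset.powersetCard k univ, ∑ a, ∑ b,
          if a ∈ A ∧ b ∉ A then swapSens c A a b else 0 := by
  classical
  obtain ⟨A, hA, hcard⟩ := exists_large_class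
    (equivalence_swap ((Fintype.card ι : ℝ) - 2 * k) d c)
  refine ⟨A, hA, ?_⟩
  have h1 : ∀ a b, γ * ((Fintype.card ι).choose k : ℝ) *
      ((if permAct (Equiv.swap a b) c - c ∈
        sliceIdeal univ ((Fintype.card ι : ℝ) - 2 * k) d then 0 else 1 : ℕ) : ℝ) ≤
      ∑ A ∈ Finset.powersetCard k univ, swapSens c A a b := by
    intro a b
    split_ifs with h
    · simpa using Finset.sum_nonneg fun A _ => swapSens_nonneg c A a b
    · have hdeg : permAct (Equiv.swap a b) c - c ∈ degLT univ (d + 1) := by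
        refine sub_mem (fun S hS => ⟨Finset.subset_univ _, ?_⟩) hc
        have := (hc _ hS).2
        rwa [Finset.card_map] at this
      rw [← Finset.card_univ] at h
      obtain ⟨r, hr, hle⟩ := choose_le_card_ev_ne_zero d univ k _ hdk hdeg h
      rw [Finset.card_univ] at hle
      rw [Nat.cast_one, mul_one]
      refine (hchoose r hr).trans ((Nat.cast_le (α := ℝ).mpr hle).trans (le_of_eq ?_))
      rw [Finset.card_filter, Nat.cast_sum]
      refine Finset.sum_congr rfl fun A _ => ?_
      rw [swapSens, ev_sub, ev_permAct]
      by_cases h' : ev c (A.map (Equiv.swap a b).toEmbedding) = ev c A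
      · simp [h']
      · simp [h', sub_eq_zero]
  calc γ * ((Fintype.card ι).choose k : ℝ) * (Fintype.card ι * Aᶜ.card)
      ≤ γ * ((Fintype.card ι).choose k : ℝ) * ((∑ a, ∑ b, if permAct (Equiv.swap a b) c - c ∈
        sliceIdeal univ ((Fintype.card ι : ℝ) - 2 * k) d then 0 else 1 : ℕ) : ℝ) := by
        refine mul_le_mul_of_nonneg_left ?_ (by positivity)
        exact_mod_cast hcard
    _ ≤ ∑ a, ∑ b, ∑ A ∈ Finset.powersetCard k univ, swapSens c A a b := by
        simp only [Nat.cast_sum, Finset.mul_sum]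
        exact Finset.sum_le_sum fun a _ => Finset.sum_le_sum fun b _ => h1 a b
    _ = _ := by
        rw [Finset.mul_sum]
        simp only [← sum_swapSens]
        rw [Finset.sum_comm' (t' := univ) (s' := fun _ => Finset.powersetCard k univ) (by simp)]
        exact Finset.sum_congr rfl fun a _ => Finset.sum_comm

/-- On an embedded cube, sensitive directions are controlled by the deviation of the values. -/
theorem sum_swapSens_subcube_le {m r d k : ℕ} (hk : m + r = k)
    (e : Fin m ⊕ Fin m ⊕ Fin r ↪ ι) {c : Finset ι → ℝ} (hc : ∀ S, d < S.card → c S = 0)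
    (hint : ∀ S, ∃ m : ℤ, c S = m * (2 : ℝ) ^ (-(d : ℤ))) {A : Finset ι}
    (hA : ∀ a ∈ A, ∀ b ∈ A, permAct (Equiv.swap a b) c - c ∈
      sliceIdeal univ ((Fintype.card ι : ℝ) - 2 * k) d) (μ : ℝ) :
    (2 : ℝ) ^ m * ∑ j, swapSens c (subcube e univ) (e (.inl j)) (e (.inr (.inl j))) ≤
      √(Aᶜ.card : ℝ) * (4 * 36 ^ d * ∑ Z, |ev c (subcube e Z) - μ|) := by
  obtain ⟨c', hc', hint', hev⟩ := exists_ev_comp (Φ := subcube e) (exists_sign_subcube e) hc hint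
  have hmain := sqrt_card_dependent_le hc' hint' μ
  set B := univ.filter fun j => ∃ Z, ev c' (symmDiff Z {j}) ≠ ev c' Z with hB
  rw [Fintype.card_fin] at hmain
  simp only [hev]
  have h1 : ∀ j ∈ B, ¬(e (.inl j) ∈ A ∧ e (.inr (.inl j)) ∈ A) := by
    rintro j hj ⟨ha, hb⟩
    obtain ⟨Z, hZ⟩ := (Finset.mem_filter.mp hj).2
    refine hZ ?_
    rw [← hev, ← hev, subcube_symmDiff, ← ev_permAct, ← sub_eq_zero, ← ev_sub]
    have h := hA _ ha _ hb
    rw [← Finset.card_univ] at h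
    exact ev_eq_zero_of_mem_sliceIdeal h
      (Finset.mem_powersetCard.mpr ⟨Finset.subset_univ _, (card_subcube e Z).trans hk⟩)
  have h2 : B.card ≤ Aᶜ.card := by
    refine Finset.card_le_card_of_injOn
      (fun j => if e (.inl j) ∈ A then e (.inr (.inl j)) else e (.inl j)) (fun j hj => ?_) ?_
    · have := h1 j hj
      simp only [Finset.coe_compl, Set.mem_compl_iff, Finset.mem_coe]
      split_ifs with h
      · exact fun h' => this ⟨h, h'⟩
      · exact h
    · intro i _ j _ hij
      dsimp only at hij
      split_ifs at hij <;> simpa using e.injective hij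
  have h3 : ∑ j, swapSens c (subcube e univ) (e (.inl j)) (e (.inr (.inl j))) ≤ B.card := by
    rw [Finset.card_filter, Nat.cast_sum]
    refine Finset.sum_le_sum fun j _ => ?_
    rw [swapSens, ← subcube_symmDiff, hev, hev]
    by_cases h : ev c' (symmDiff univ {j}) = ev c' univ
    · simp only [h, ne_eq, not_true_eq_false, if_false]
      positivity
    · rw [if_pos h, if_pos ⟨univ, h⟩, Nat.cast_one]
  have h4 : (B.card : ℝ) = √(B.card : ℝ) * √(B.card : ℝ) :=
    (Real.mul_self_sqrt (Nat.cast_nonneg _)).symm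
  calc (2 : ℝ) ^ m * ∑ j, swapSens c (subcube e univ) (e (.inl j)) (e (.inr (.inl j)))
      ≤ 2 ^ m * B.card := mul_le_mul_of_nonneg_left h3 (by positivity)
    _ = √(B.card : ℝ) * (2 ^ m * √(B.card : ℝ)) := by rw [mul_left_comm, ← h4]
    _ ≤ √(Aᶜ.card : ℝ) * (2 ^ m * √(B.card : ℝ)) :=
        mul_le_mul_of_nonneg_right (Real.sqrt_le_sqrt (Nat.cast_le.mpr h2))
          (mul_nonneg (pow_nonneg zero_le_two m) (Real.sqrt_nonneg _))
    _ ≤ _ := mul_le_mul_of_nonneg_left hmain (Real.sqrt_nonneg _)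

/-- Upper bound for the number of sensitive pairs in terms of the deviation on the slice. -/
theorem sum_swapSens_slice_le {k d : ℕ} (hk0 : 0 < k) (hkn : k < Fintype.card ι)
    {c : Finset ι → ℝ} (hc : ∀ S, d < S.card → c S = 0)
    (hint : ∀ S, ∃ m : ℤ, c S = m * (2 : ℝ) ^ (-(d : ℤ))) {A : Finset ι}
    (hA : ∀ a ∈ A, ∀ b ∈ A, permAct (Equiv.swap a b) c - c ∈
      sliceIdeal univ ((Fintype.card ι : ℝ) - 2 * k) d) (μ : ℝ) :
    ∑ A ∈ Finset.powersetCard k univ, ∑ a, ∑ b,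
        (if a ∈ A ∧ b ∉ A then swapSens c A a b else 0) ≤
      Fintype.card ι * √(Aᶜ.card : ℝ) * (4 * 36 ^ d) *
        ∑ A ∈ Finset.powersetCard k univ, |ev c A - μ| := by
  set n := Fintype.card ι with hn
  set T := ∑ A ∈ Finset.powersetCard k univ, ∑ a, ∑ b,
    (if a ∈ A ∧ b ∉ A then swapSens c A a b else 0) with hT
  set W := ∑ A ∈ Finset.powersetCard k univ, |ev c A - μ| with hW
  set N : ℝ := (Fintype.card (Equiv.Perm ι) : ℝ) with hN
  have hN0 : 0 < N := by rw [hN]; exact_mod_cast Fintype.card_pos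
  have hC0 : 0 < (n.choose k : ℝ) := by exact_mod_cast Nat.choose_pos hkn.le
  have hW0 : 0 ≤ W := Finset.sum_nonneg fun _ _ => abs_nonneg _
  obtain ⟨m, r, hmr, hm0, hle, hprod⟩ : ∃ m r, m + r = k ∧ 0 < m ∧ m + (m + r) ≤ n ∧
      (k * (n - k : ℕ) : ℝ) ≤ m * n := by
    rcases le_total k (n - k) with h | h
    · refine ⟨k, 0, rfl, hk0, by omega, ?_⟩
      exact_mod_cast Nat.mul_le_mul_left k (Nat.sub_le n k)
    · refine ⟨n - k, k - (n - k), by omega, by omega, by omega, ?_⟩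
      rw [mul_comm]
      exact_mod_cast Nat.mul_le_mul_left (n - k) hkn.le
  obtain ⟨e⟩ : Nonempty (Fin m ⊕ Fin m ⊕ Fin r ↪ ι) :=
    Function.Embedding.nonempty_of_card_le (by simpa using hle)
  have hpair : ∀ j, (n.choose k : ℝ) * k * (n - k : ℕ) * ∑ σ : Equiv.Perm ι,
      swapSens c ((subcube e univ).map σ.toEmbedding) (σ (e (.inl j))) (σ (e (.inr (.inl j)))) =
      N * T := fun j =>
    choose_mul_sum_perm_pair ((card_subcube e univ).trans hmr)
      ((inl_mem_subcube e univ j).mpr (Finset.mem_univ j))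
      (fun h => (inr_inl_mem_subcube e univ j).mp h (Finset.mem_univ j)) (swapSens c)
  have hsingle : ∀ Z, (n.choose k : ℝ) * ∑ σ : Equiv.Perm ι,
      |ev c ((subcube e Z).map σ.toEmbedding) - μ| = N * W := fun Z =>
    choose_mul_sum_perm ((card_subcube e Z).trans hmr) fun A => |ev c A - μ|
  have hsum := Finset.sum_le_sum fun (σ : Equiv.Perm ι) (_ : σ ∈ univ) =>
    sum_swapSens_subcube_le hmr (e.trans σ.toEmbedding) hc hint hA μ
  simp only [← map_subcube, ← Finset.mul_sum] at hsum
  rw [Finset.sum_comm, Finset.sum_comm (s := (univ : Finset (Equiv.Perm ι)))] at hsum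
  have h1 := mul_le_mul_of_nonneg_left hsum
    (show 0 ≤ (n.choose k : ℝ) * k * (n - k : ℕ) by positivity)
  have h2 : (n.choose k : ℝ) * k * (n - k : ℕ) * (2 ^ m * ∑ j, ∑ σ : Equiv.Perm ι,
      swapSens c ((subcube e univ).map σ.toEmbedding) (σ (e (.inl j))) (σ (e (.inr (.inl j))))) =
      2 ^ m * (m * (N * T)) := by
    rw [mul_left_comm, Finset.mul_sum, Finset.sum_congr rfl fun j _ => hpair j]
    simp
  have h3 : (n.choose k : ℝ) * k * (n - k : ℕ) * (√(Aᶜ.card : ℝ) * (4 * 36 ^ d *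
      ∑ Z, ∑ σ : Equiv.Perm ι, |ev c ((subcube e Z).map σ.toEmbedding) - μ|)) =
      2 ^ m * (k * (n - k : ℕ) * (√(Aᶜ.card : ℝ) * (4 * 36 ^ d)) * (N * W)) := by
    have : (n.choose k : ℝ) *
        ∑ Z, ∑ σ : Equiv.Perm ι, |ev c ((subcube e Z).map σ.toEmbedding) - μ| =
        2 ^ m * (N * W) := by
      rw [Finset.mul_sum, Finset.sum_congr rfl fun j _ => hsingle j]
      simp
    linear_combination k * (n - k : ℕ) * (√(Aᶜ.card : ℝ) * (4 * 36 ^ d)) * this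
  have h4 : (m : ℝ) * (N * T) ≤ k * (n - k : ℕ) * (√(Aᶜ.card : ℝ) * (4 * 36 ^ d)) * (N * W) :=
    le_of_mul_le_mul_left ((h2.symm.trans_le h1).trans_eq h3) (by positivity)
  have h5 : (m : ℝ) * (N * T) ≤ m * n * (√(Aᶜ.card : ℝ) * (4 * 36 ^ d)) * (N * W) :=
    h4.trans (by gcongr)
  have h6 : (m * N) * T ≤ (m * N) * (n * √(Aᶜ.card : ℝ) * (4 * 36 ^ d) * W) := by
    linarith
  exact le_of_mul_le_mul_left h6 (by positivity)

end SwapClasses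

section SliceBounds

theorem sq_mul_choose_le_choose {n k : ℕ} {δ : ℝ} (hδ : 0 ≤ δ) (h1 : δ * n + 1 ≤ k)
    (h2 : δ * n + 1 ≤ (n : ℝ) - k) :
    δ ^ 2 * (n.choose k : ℝ) ≤ ((n - 2).choose (k - 1) : ℝ) := by
  have hk : 1 ≤ k := by
    have : (1 : ℝ) ≤ k := le_trans (le_add_of_nonneg_left (by positivity)) h1
    exact_mod_cast this
  have hkn : k + 1 ≤ n := by
    have : (k : ℝ) + 1 ≤ n := by linarith [mul_nonneg hδ (Nat.cast_nonneg (α := ℝ) n)]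
    exact_mod_cast this
  obtain ⟨k, rfl⟩ := Nat.exists_eq_add_of_le' hk
  obtain ⟨n, rfl⟩ : ∃ n', n = n' + 2 := ⟨n - 2, by omega⟩
  have e1 : ((n + 2).choose (k + 1) : ℝ) * (k + 1) = (n + 2) * (n + 1).choose k := by
    exact_mod_cast (Nat.add_one_mul_choose_eq (n + 1) k).symm
  have e2 : ((n + 1).choose k : ℝ) * (n + 1 - k) = (n + 1) * n.choose k := by
    have h := Nat.choose_mul_succ_eq n k
    rw [← Nat.cast_inj (R := ℝ)] at h
    push_cast [Nat.cast_sub (show k ≤ n + 1 by omega)] at h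
    linarith
  have hC : (0 : ℝ) ≤ ((n + 2).choose (k + 1) : ℝ) := Nat.cast_nonneg _
  push_cast at h1 h2
  change _ ≤ (n.choose k : ℝ)
  have e3 : ((n + 2).choose (k + 1) : ℝ) * ((k + 1) * (n + 1 - k)) =
      n.choose k * ((n + 2) * (n + 1)) := by
    linear_combination (n + 1 - k : ℝ) * e1 + (n + 2 : ℝ) * e2
  have h3 : δ ^ 2 * ((n + 2) * (n + 1)) ≤ ((k + 1) * (n + 1 - k) : ℝ) :=
    calc δ ^ 2 * ((n + 2) * (n + 1)) ≤ (δ * (n + 2)) * (δ * (n + 2)) := by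
          nlinarith [sq_nonneg δ, mul_nonneg (sq_nonneg δ) (show (0 : ℝ) ≤ n + 2 by positivity)]
      _ ≤ _ := mul_le_mul (by linarith) (by linarith) (by positivity) (by positivity)
  refine le_of_mul_le_mul_right (a := ((n : ℝ) + 2) * (n + 1)) ?_ (by positivity)
  rw [← e3]
  linarith [mul_le_mul_of_nonneg_left h3 hC]

theorem pow_mul_choose_le_choose {δ : ℝ} (hδ : 0 ≤ δ) : ∀ (r n k : ℕ), δ * n + r ≤ k →
    δ * n + r ≤ (n : ℝ) - k →
    (δ ^ 2) ^ r * (n.choose k : ℝ) ≤ ((n - 2 * r).choose (k - r) : ℝ)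
  | 0, n, k, _, _ => by simp
  | r + 1, n, k, h1, h2 => by
    push_cast at h1 h2
    have hδn : 0 ≤ δ * n := by positivity
    have hr : (0 : ℝ) ≤ r := Nat.cast_nonneg r
    have hk : 1 ≤ k := by
      have : (1 : ℝ) ≤ k := by linarith
      exact_mod_cast this
    have hkn : k + 1 ≤ n := by
      have : (k : ℝ) + 1 ≤ n := by linarith
      exact_mod_cast this
    have h3 := sq_mul_choose_le_choose (n := n) (k := k) hδ (by linarith) (by linarith)
    have h4 := pow_mul_choose_le_choose hδ r (n - 2) (k - 1)
      (by push_cast [Nat.cast_sub hk, Nat.cast_sub (show 2 ≤ n by omega)]; linarith)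
      (by push_cast [Nat.cast_sub hk, Nat.cast_sub (show 2 ≤ n by omega)]; linarith)
    rw [show n - 2 * (r + 1) = n - 2 - 2 * r by omega, show k - (r + 1) = k - 1 - r by omega]
    refine le_trans ?_ h4
    rw [pow_succ, mul_assoc]
    exact mul_le_mul_of_nonneg_left h3 (by positivity)

theorem sum_abs_sub_mean_le {α : Type*} {s : Finset α} {F : α → ℝ} {t : ℝ}
    (h : ∀ x ∈ s, F x ≤ (∑ y ∈ s, F y) / s.card + t) (ht : 0 ≤ t) :
    ∑ x ∈ s, |F x - (∑ y ∈ s, F y) / s.card| ≤ 2 * t * s.card := by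
  set μ := (∑ y ∈ s, F y) / s.card with hμ
  have h1 : ∀ x ∈ s, |F x - μ| ≤ 2 * t - (F x - μ) := by
    intro x hx
    have := h x hx
    exact abs_le.mpr ⟨by linarith, by linarith⟩
  have h2 : ∑ x ∈ s, (F x - μ) = 0 := by
    rcases s.eq_empty_or_nonempty with rfl | hs
    · simp
    · have : (s.card : ℝ) ≠ 0 := by exact_mod_cast hs.card_pos.ne'
      rw [Finset.sum_sub_distrib, Finset.sum_const, nsmul_eq_mul, hμ, mul_div_cancel₀ _ this,
        sub_self]
  refine (Finset.sum_le_sum h1).trans_eq ?_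
  rw [Finset.sum_sub_distrib, h2, Finset.sum_const, nsmul_eq_mul]
  ring

variable {ι : Type*} [Fintype ι] [DecidableEq ι]

/-- A granular polynomial of low degree which does not exceed its mean by more than `t` on the
slice is congruent to a polynomial with few active variables. -/
theorem exists_mem_sliceIdeal_card_le {k d : ℕ} {γ t : ℝ} (hγ : 0 < γ) (ht : 0 ≤ t) (hk0 : 0 < k)
    (hkn : k < Fintype.card ι) (hdk : d ≤ k)
    (hchoose : ∀ r ≤ d, γ * ((Fintype.card ι).choose k : ℝ) ≤
      ((Fintype.card ι - 2 * r).choose (k - r) : ℝ))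
    {c : Finset ι → ℝ} (hc : ∀ S, d < S.card → c S = 0)
    (hint : ∀ S, ∃ m : ℤ, c S = m * (2 : ℝ) ^ (-(d : ℤ)))
    (hmax : ∀ A ∈ Finset.powersetCard k univ, ev c A ≤
      (∑ B ∈ Finset.powersetCard k univ, ev c B) / (Fintype.card ι).choose k + t) :
    ∃ c', c' - c ∈ sliceIdeal univ ((Fintype.card ι : ℝ) - 2 * k) d ∧
      ∃ U : Finset ι, (∀ S, c' S ≠ 0 → S ⊆ U) ∧ (U.card : ℝ) ≤ (16 * 36 ^ d / γ) ^ 2 * t ^ 2 := by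
  have hne : Nonempty ι := Fintype.card_pos_iff.mp (hk0.trans hkn)
  have hdeg : c ∈ degLT univ (d + 1) := fun S hS =>
    ⟨Finset.subset_univ S, Nat.lt_succ_of_le (not_lt.mp fun h => hS (hc S h))⟩
  obtain ⟨A, hA, hlow⟩ := exists_class_card_mul_le hγ.le hdk hchoose hdeg
  obtain ⟨c', hc', hsupp⟩ := exists_eliminate (Finset.subset_univ A) _ hdeg hA
  refine ⟨c', hc', Aᶜ, fun S hS => (hsupp S hS).trans (Finset.compl_eq_univ_sdiff A).ge, ?_⟩
  have hcard : (Finset.powersetCard k (univ : Finset ι)).card = (Fintype.card ι).choose k := by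
    rw [Finset.card_powersetCard, Finset.card_univ]
  rw [← hcard] at hmax
  have hup := sum_swapSens_slice_le hk0 hkn hc hint hA
    ((∑ B ∈ Finset.powersetCard k univ, ev c B) / (Finset.powersetCard k (univ : Finset ι)).card)
  have hdev := sum_abs_sub_mean_le hmax ht
  rw [hcard] at hup hdev
  set n : ℝ := (Fintype.card ι : ℝ) with hn
  set s : ℝ := (Aᶜ.card : ℝ) with hs
  set M : ℝ := ((Fintype.card ι).choose k : ℝ) with hM
  have hn0 : 0 < n := by
    rw [hn]
    exact_mod_cast hk0.trans hkn
  have hM0 : 0 < M := by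
    rw [hM]
    exact_mod_cast Nat.choose_pos hkn.le
  have hs0 : 0 ≤ s := Nat.cast_nonneg _
  have h1 : (M * n) * (γ * s) ≤ (M * n) * (16 * 36 ^ d * t * √s) := by
    have := mul_le_mul_of_nonneg_left hdev
      (show 0 ≤ n * √s * (4 * 36 ^ d) by positivity)
    linarith
  have h2 : γ * (√s * √s) ≤ 16 * 36 ^ d * t * √s := by
    rw [Real.mul_self_sqrt hs0]
    exact le_of_mul_le_mul_left h1 (by positivity)
  have h3 : √s ≤ 16 * 36 ^ d / γ * t := by
    rcases (Real.sqrt_nonneg s).eq_or_lt with h0 | h0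
    · rw [← h0]
      positivity
    · rw [div_mul_eq_mul_div, le_div_iff₀ hγ, mul_comm]
      exact le_of_mul_le_mul_right (by linarith) h0
  calc s = √s ^ 2 := (Real.sq_sqrt hs0).symm
    _ ≤ (16 * 36 ^ d / γ * t) ^ 2 := by gcongr
    _ = _ := mul_pow _ _ _

end SliceBounds

section BooleanAssignments

variable {n : ℕ}

/-- The set of coordinates where an assignment takes the value `-1`. -/
def negSet (σ : Fin n → Bool) : Finset (Fin n) := univ.filter fun i => σ i = false

theorem intSum_eq (σ : Fin n → Bool) : intSum σ = (n : ℤ) - 2 * (negSet σ).card := by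
  have h : ∀ i, (if σ i then (1 : ℤ) else -1) = 1 - 2 * if σ i = false then 1 else 0 := by
    intro i
    cases σ i <;> simp
  rw [intSum, Finset.sum_congr rfl fun i _ => h i, Finset.sum_sub_distrib, ← Finset.mul_sum,
    negSet, Finset.sum_boole]
  simp

theorem evalML_signs (c : Finset (Fin n) → ℝ) (σ : Fin n → Bool) :
    evalML c (signs σ) = ev c (negSet σ) := by
  refine Finset.sum_congr rfl fun S _ => ?_
  rw [chi_eq_prod]
  congr 1
  refine Finset.prod_congr rfl fun i _ => ?_
  cases h : σ i <;> simp [signs, negSet, h]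

theorem negSet_decide (A : Finset (Fin n)) : negSet (fun i => decide (i ∉ A)) = A := by
  ext i
  simp [negSet]

theorem intSum_eq_iff (σ : Fin n → Bool) (k : ℕ) :
    intSum σ = (n : ℤ) - 2 * k ↔ negSet σ ∈ Finset.powersetCard k univ := by
  rw [intSum_eq, Finset.mem_powersetCard_univ]
  omega

theorem decide_notMem_negSet (σ : Fin n → Bool) : (fun i => decide (i ∉ negSet σ)) = σ := by
  funext i
  cases h : σ i <;> simp [negSet, h]

theorem sum_cardSet (k : ℕ) (F : Finset (Fin n) → ℝ) :
    ∑ σ ∈ cardSet n k, F (negSet σ) = ∑ A ∈ Finset.powersetCard k univ, F A := by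
  refine Finset.sum_nbij' negSet (fun A i => decide (i ∉ A)) (fun σ hσ => ?_) (fun A hA => ?_)
    (fun σ _ => decide_notMem_negSet σ) (fun A _ => negSet_decide A) fun _ _ => rfl
  · exact (intSum_eq_iff σ k).mp (Finset.mem_filter.mp hσ).2
  · refine Finset.mem_filter.mpr ⟨Finset.mem_univ _, (intSum_eq_iff _ k).mpr ?_⟩
    rwa [negSet_decide]

theorem expOver_cardSet (k : ℕ) (c : Finset (Fin n) → ℝ) :
    expOver (cardSet n k) (fun σ => evalML c (signs σ)) =
      (∑ A ∈ Finset.powersetCard k univ, ev c A) / (n.choose k : ℝ) := by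
  have h : ((cardSet n k).card : ℝ) = (n.choose k : ℝ) := by
    have := sum_cardSet (n := n) k fun _ => 1
    simpa using this
  simp only [expOver, evalML_signs, h, sum_cardSet k (ev c)]

end BooleanAssignments

theorem stmt1 (d : ℕ) (hd : 1 ≤ d) (p₀ : ℝ) (hp₀ : 0 < p₀) (hp₀' : p₀ ≤ 1 / 2) :
    ∃ C : ℝ, 0 < C ∧
      ∀ t : ℝ, 1 ≤ t → ∃ n₀ : ℕ, ∀ n : ℕ, n₀ ≤ n →
        ∀ p : ℝ, p₀ ≤ p → p ≤ 1 - p₀ → ∀ k : ℕ, (k : ℝ) = p * n →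
        ∀ c : Finset (Fin n) → ℝ,
          (∀ S, d < S.card → c S = 0) →
          (∀ S, ∃ m : ℤ, c S = m * (2 : ℝ) ^ (-(d : ℤ))) →
          (∃ σ : Fin n → Bool, intSum σ = (n : ℤ) - 2 * k ∧
              evalML c (signs σ) ≥ expOver (cardSet n k) (fun τ => evalML c (signs τ)) + t) ∨
          (∃ h : Finset (Fin n) → ℝ, (∀ S, d - 1 < S.card → h S = 0) ∧
              ({i : Fin n | ∃ S : Finset (Fin n), i ∈ S ∧
                  c S - (mulSum h S - (1 - 2 * p) * n * h S) ≠ 0}.ncard : ℝ)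
                ≤ C * t ^ 2) := by
  set δ : ℝ := p₀ / 2 with hδ
  have hp₀δ : p₀ = 2 * δ := by rw [hδ]; ring
  have hδ0 : 0 < δ := by positivity
  have hδ1 : δ ^ 2 ≤ 1 := pow_le_one₀ hδ0.le (by linarith)
  set γ : ℝ := (δ ^ 2) ^ d with hγ
  have hγ0 : 0 < γ := by positivity
  refine ⟨(16 * 36 ^ d / γ) ^ 2, by positivity, fun t ht =>
    ⟨⌈d / δ⌉₊, fun n hn p hp hp' k hk c hc hint => ?_⟩⟩
  have hdn : (d : ℝ) ≤ δ * n := by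
    have := Nat.ceil_le.mp hn
    rwa [div_le_iff₀' hδ0] at this
  have hd0 : (1 : ℝ) ≤ d := by exact_mod_cast hd
  have hkl : δ * n + d ≤ k := by
    have : p₀ * n ≤ p * n := by gcongr
    rw [hp₀δ] at this
    rw [hk]
    linarith
  have hku : δ * n + d ≤ (n : ℝ) - k := by
    have : p * n ≤ (1 - p₀) * n := by gcongr
    rw [hp₀δ] at this
    rw [hk]
    linarith
  have hdk : d ≤ k := by
    have : (d : ℝ) ≤ k := by linarith
    exact_mod_cast this
  have hkn : k < n := by
    have : (k : ℝ) < n := by linarith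
    exact_mod_cast this
  have hchoose : ∀ r ≤ d, γ * (n.choose k : ℝ) ≤ ((n - 2 * r).choose (k - r) : ℝ) := by
    intro r hr
    have hr' : (r : ℝ) ≤ d := by exact_mod_cast hr
    refine le_trans ?_ (pow_mul_choose_le_choose hδ0.le r n k (by linarith) (by linarith))
    exact mul_le_mul_of_nonneg_right (pow_le_pow_of_le_one (by positivity) hδ1 hr)
      (Nat.cast_nonneg _)
  by_cases hmax : ∃ A ∈ Finset.powersetCard k univ,
      (∑ B ∈ Finset.powersetCard k univ, ev c B) / (n.choose k : ℝ) + t < ev c A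
  · obtain ⟨A, hA, hlt⟩ := hmax
    refine Or.inl ⟨fun i => decide (i ∉ A), (intSum_eq_iff _ k).mpr ?_, ?_⟩
    · rwa [negSet_decide]
    · rw [evalML_signs, negSet_decide, expOver_cardSet]
      exact hlt.le
  · push Not at hmax
    obtain ⟨c', ⟨h, hh, hc'⟩, U, hU, hcard⟩ := exists_mem_sliceIdeal_card_le (ι := Fin n)
      (k := k) (d := d) hγ0 (zero_le_one.trans ht) (hd.trans hdk) (by rwa [Fintype.card_fin]) hdk
      (by rwa [Fintype.card_fin]) hc hint (by rwa [Fintype.card_fin])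
    refine Or.inr ⟨-h, fun S hS => ?_, le_trans ?_ hcard⟩
    · by_contra h0
      have := (hh S fun h1 => h0 (by simp [h1])).2
      omega
    · rw [← Set.ncard_coe_finset U]
      refine Nat.cast_le.mpr (Set.ncard_le_ncard ?_ U.finite_toSet)
      rintro i ⟨S, hi, hS⟩
      refine hU S (fun h0 => hS ?_) hi
      have h1 := congrFun hc' S
      rw [mulLinear_apply, Pi.sub_apply, h0, Fintype.card_fin, hk] at h1
      simp only [mulSum, Pi.neg_apply, Finset.sum_neg_distrib]
      linarith
end

section
/- For every integer d ≥ 1 there exists n₀ depending only on d such that for all even n ≥ n₀ and every multilinear polynomial g of degree at most d on n variables, E_D[g⁴] ≤ 3d · 9^{2d} · ‖g‖₂⁴. -/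
open Finset

/-- The set of assignments satisfying the bisection constraint `∑ i x i = 0`. -/
def bisSet (n : ℕ) : Finset (Fin n → Bool) := Finset.univ.filter fun σ => intSum σ = 0

/-! ### Characters of the Boolean cube -/

lemma signs_mul_self {n : ℕ} (σ : Fin n → Bool) (i : Fin n) : signs σ i * signs σ i = 1 := by
  unfold signs; split_ifs <;> norm_num

lemma prod_signs_mul {n : ℕ} (σ : Fin n → Bool) (S T : Finset (Fin n)) :
    (∏ i ∈ S, signs σ i) * ∏ i ∈ T, signs σ i = ∏ i ∈ symmDiff S T, signs σ i := by
  have key (R : Finset (Fin n)) :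
      ∏ i ∈ R, signs σ i = ∏ i, if i ∈ R then signs σ i else 1 := by
    rw [prod_ite_mem, univ_inter]
  rw [key, key, key, ← prod_mul_distrib]
  refine prod_congr rfl fun i _ => ?_
  by_cases h₁ : i ∈ S <;> by_cases h₂ : i ∈ T <;> simp [h₁, h₂, mem_symmDiff, signs_mul_self]

lemma sum_prod_signs {n : ℕ} (S : Finset (Fin n)) :
    ∑ σ : Fin n → Bool, ∏ i ∈ S, signs σ i = if S = ∅ then 2 ^ n else 0 := by
  have h : ∀ σ : Fin n → Bool, ∏ i ∈ S, signs σ i =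
      ∏ i, if i ∈ S then (if σ i then (1 : ℝ) else -1) else 1 := by
    intro σ
    rw [prod_ite_mem, univ_inter]
    rfl
  simp_rw [h]
  rw [← Fintype.prod_sum fun (i : Fin n) (b : Bool) =>
    if i ∈ S then (if b then (1 : ℝ) else -1) else 1]
  split_ifs with hS
  · subst hS
    simp
  · obtain ⟨a, ha⟩ := nonempty_iff_ne_empty.2 hS
    exact prod_eq_zero (mem_univ a) (by simp [ha])

/-- Parseval's identity on the Boolean cube. -/
lemma sum_evalML_sq {n : ℕ} (c : Finset (Fin n) → ℝ) :
    ∑ σ, evalML c (signs σ) ^ 2 = 2 ^ n * ∑ S, c S ^ 2 := by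
  have h (σ : Fin n → Bool) : evalML c (signs σ) ^ 2 =
      ∑ S, ∑ T, c S * c T * ∏ i ∈ symmDiff S T, signs σ i := by
    rw [sq, evalML, sum_mul_sum]
    refine sum_congr rfl fun S _ => sum_congr rfl fun T _ => ?_
    rw [← prod_signs_mul]
    ring
  simp_rw [h]
  rw [sum_comm, mul_sum]
  refine sum_congr rfl fun S _ => ?_
  rw [sum_comm]
  simp_rw [← mul_sum, sum_prod_signs, ← bot_eq_empty, symmDiff_eq_bot]
  simp
  ring

/-- Coefficients of the multilinear reduction of a product. -/
def mulML {n : ℕ} (a b : Finset (Fin n) → ℝ) (U : Finset (Fin n)) : ℝ :=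
  ∑ S, ∑ T, if symmDiff S T = U then a S * b T else 0

lemma evalML_mulML {n : ℕ} (a b : Finset (Fin n) → ℝ) (σ : Fin n → Bool) :
    evalML (mulML a b) (signs σ) = evalML a (signs σ) * evalML b (signs σ) := by
  unfold evalML mulML
  simp_rw [sum_mul]
  rw [sum_comm]
  refine sum_congr rfl fun S _ => ?_
  rw [sum_comm, mul_sum]
  refine sum_congr rfl fun T _ => ?_
  simp_rw [ite_mul, zero_mul]
  rw [sum_ite_eq, if_pos (mem_univ _), ← prod_signs_mul]
  ring

lemma mulML_eq_zero {n k l : ℕ} {a b : Finset (Fin n) → ℝ} (ha : ∀ S, k < S.card → a S = 0)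
    (hb : ∀ S, l < S.card → b S = 0) (U : Finset (Fin n)) (hU : k + l < U.card) :
    mulML a b U = 0 := by
  refine sum_eq_zero fun S _ => sum_eq_zero fun T _ => ?_
  split_ifs with h
  · rcases lt_or_ge k S.card with hS | hS
    · rw [ha S hS, zero_mul]
    rcases lt_or_ge l T.card with hT | hT
    · rw [hb T hT, mul_zero]
    have h₁ : symmDiff S T ⊆ S ∪ T := symmDiff_le_sup
    have := (card_le_card h₁).trans (card_union_le S T)
    rw [h] at this
    omega
  · rfl

/-! ### Hypercontractivity -/

/-- Flipping one bit. -/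
def flipBit {n : ℕ} (a : Fin n) (σ : Fin n → Bool) : Fin n → Bool := Function.update σ a (!σ a)

lemma flipBit_involutive {n : ℕ} (a : Fin n) : Function.Involutive (flipBit a) := by
  intro σ
  simp [flipBit]

lemma signs_flipBit_self {n : ℕ} (a : Fin n) (σ : Fin n → Bool) :
    signs (flipBit a σ) a = - signs σ a := by
  cases h : σ a <;> simp [signs, flipBit, h]

lemma signs_flipBit_of_ne {n : ℕ} {a i : Fin n} (h : i ≠ a) (σ : Fin n → Bool) :
    signs (flipBit a σ) i = signs σ i := by
  simp [signs, flipBit, h]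

lemma evalML_flipBit {n : ℕ} {a : Fin n} {c : Finset (Fin n) → ℝ} (hc : ∀ S, a ∈ S → c S = 0)
    (σ : Fin n → Bool) : evalML c (signs (flipBit a σ)) = evalML c (signs σ) := by
  refine sum_congr rfl fun S _ => ?_
  by_cases ha : a ∈ S
  · simp [hc S ha]
  · congr 1
    refine prod_congr rfl fun i hi => signs_flipBit_of_ne ?_ σ
    rintro rfl
    exact ha hi

lemma evalML_eq_add {n : ℕ} (a : Fin n) (c : Finset (Fin n) → ℝ) (x : Fin n → ℝ) :
    evalML c x = evalML (fun S => if a ∈ S then 0 else c S) x +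
      x a * evalML (fun S => if a ∈ S then 0 else c (insert a S)) x := by
  have key (F : Finset (Fin n) → ℝ) :
      ∑ S, F S = ∑ S ∈ (univ.erase a).powerset, (F S + F (insert a S)) := by
    rw [← powerset_univ, ← insert_erase (mem_univ a), sum_powerset_insert (by simp),
      sum_add_distrib]
    simp
  unfold evalML
  rw [key, key, key, mul_sum, ← sum_add_distrib]
  refine sum_congr rfl fun S hS => ?_
  have ha : a ∉ S := fun h => by simpa using mem_powerset.1 hS h
  simp [ha, prod_insert ha]
  ring

/-- The Bonami lemma: a polynomial `f` of degree at most `d` on the cube satisfies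
`E[f ^ 4] ≤ 9 ^ d * E[f ^ 2] ^ 2`. -/
lemma bonami {n : ℕ} (A : Finset (Fin n)) : ∀ (d : ℕ) (c : Finset (Fin n) → ℝ),
    (∀ S, d < S.card → c S = 0) → (∀ S, ¬ S ⊆ A → c S = 0) →
    2 ^ n * ∑ σ, evalML c (signs σ) ^ 4 ≤ 9 ^ d * (∑ σ, evalML c (signs σ) ^ 2) ^ 2 := by
  induction A using Finset.induction_on with
  | empty =>
    intro d c _ hA
    have h (σ : Fin n → Bool) : evalML c (signs σ) = c ∅ := by
      unfold evalML
      rw [sum_eq_single ∅ (fun S _ hS => by rw [hA S (by simpa using hS), zero_mul]) (by simp)]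
      simp
    simp_rw [h]
    simp only [sum_const, card_univ, Fintype.card_fun, Fintype.card_bool, Fintype.card_fin,
      nsmul_eq_mul]
    push_cast
    have h9 : (1 : ℝ) ≤ 9 ^ d := one_le_pow₀ (by norm_num)
    nlinarith [mul_le_mul_of_nonneg_right h9 (sq_nonneg ((2 : ℝ) ^ n * c ∅ ^ 2))]
  | insert a A haA ih =>
    intro d c hd hA
    set c₀ : Finset (Fin n) → ℝ := fun S => if a ∈ S then 0 else c S with hc₀
    set c₁ : Finset (Fin n) → ℝ := fun S => if a ∈ S then 0 else c (insert a S) with hc₁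
    have hsplit (σ : Fin n → Bool) : evalML c (signs σ) =
        evalML c₀ (signs σ) + signs σ a * evalML c₁ (signs σ) := evalML_eq_add a c _
    have hd₀ : ∀ S, d < S.card → c₀ S = 0 := fun S hS => by simp [hc₀, hd S hS]
    have hA₀ : ∀ S, ¬ S ⊆ A → c₀ S = 0 := by
      intro S hS
      by_cases ha : a ∈ S
      · simp [hc₀, ha]
      · simp only [hc₀, ha, if_false]
        exact hA S fun h => hS ((subset_insert_iff_of_notMem ha).1 h)
    have hA₁ : ∀ S, ¬ S ⊆ A → c₁ S = 0 := by
      intro S hS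
      by_cases ha : a ∈ S
      · simp [hc₁, ha]
      · simp only [hc₁, ha, if_false]
        exact hA _ fun h => hS ((insert_subset_insert_iff ha).1 h)
    have IH₀ := ih d c₀ hd₀ hA₀
    rcases d with _ | d
    · have hz : c₁ = 0 := by
        funext S
        simp only [hc₁, Pi.zero_apply]
        split_ifs
        · rfl
        · exact hd _ (card_pos.2 (insert_nonempty _ _))
      have h (σ : Fin n → Bool) : evalML c (signs σ) = evalML c₀ (signs σ) := by
        rw [hsplit, hz]
        simp [evalML]
      simpa only [h] using IH₀
    have hd₁ : ∀ S, d < S.card → c₁ S = 0 := by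
      intro S hS
      by_cases ha : a ∈ S
      · simp [hc₁, ha]
      · simp only [hc₁, ha, if_false]
        exact hd _ (by rw [card_insert_of_notMem ha]; omega)
    have IH₁ := ih d c₁ hd₁ hA₁
    have hflip (F : (Fin n → Bool) → ℝ) :
        ∑ σ, F σ = ∑ σ, (F σ + F (flipBit a σ)) / 2 := by
      have h : ∑ σ, F (flipBit a σ) = ∑ σ, F σ :=
        Equiv.sum_comp (Function.Involutive.toPerm _ (flipBit_involutive a)) F
      rw [← sum_div, sum_add_distrib, h]
      ring
    have hf (σ : Fin n → Bool) : evalML c (signs (flipBit a σ)) =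
        evalML c₀ (signs σ) - signs σ a * evalML c₁ (signs σ) := by
      rw [hsplit, signs_flipBit_self, evalML_flipBit (by simp +contextual [hc₀]),
        evalML_flipBit (by simp +contextual [hc₁])]
      ring
    have hsq (σ : Fin n → Bool) : signs σ a ^ 2 = 1 := by rw [sq, signs_mul_self]
    have h2 : ∑ σ, evalML c (signs σ) ^ 2 =
        ∑ σ, evalML c₀ (signs σ) ^ 2 + ∑ σ, evalML c₁ (signs σ) ^ 2 := by
      rw [hflip, ← sum_add_distrib]
      refine sum_congr rfl fun σ _ => ?_
      rw [hf, hsplit]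
      linear_combination evalML c₁ (signs σ) ^ 2 * hsq σ
    have h4 : ∑ σ, evalML c (signs σ) ^ 4 = ∑ σ, evalML c₀ (signs σ) ^ 4 +
        6 * ∑ σ, evalML c₀ (signs σ) ^ 2 * evalML c₁ (signs σ) ^ 2 +
          ∑ σ, evalML c₁ (signs σ) ^ 4 := by
      rw [hflip, mul_sum, ← sum_add_distrib, ← sum_add_distrib]
      refine sum_congr rfl fun σ _ => ?_
      rw [hf, hsplit]
      linear_combination (6 * evalML c₀ (signs σ) ^ 2 * evalML c₁ (signs σ) ^ 2 +
        evalML c₁ (signs σ) ^ 4 * (signs σ a ^ 2 + 1)) * hsq σ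
    have hcs := sum_mul_sq_le_sq_mul_sq univ
      (fun σ : Fin n → Bool => evalML c₀ (signs σ) ^ 2) (fun σ => evalML c₁ (signs σ) ^ 2)
    simp only [← pow_mul, Nat.reduceMul] at hcs
    have hP : 0 ≤ ∑ σ, evalML c₀ (signs σ) ^ 4 := sum_nonneg fun σ _ => by positivity
    have hQ : 0 ≤ ∑ σ, evalML c₁ (signs σ) ^ 4 := sum_nonneg fun σ _ => by positivity
    have hp : 0 ≤ ∑ σ, evalML c₀ (signs σ) ^ 2 := sum_nonneg fun σ _ => by positivity
    have hq : 0 ≤ ∑ σ, evalML c₁ (signs σ) ^ 2 := sum_nonneg fun σ _ => by positivity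
    rw [h2, h4]
    generalize ∑ σ, evalML c₀ (signs σ) ^ 4 = P at *
    generalize ∑ σ, evalML c₁ (signs σ) ^ 4 = Q at *
    generalize ∑ σ, evalML c₀ (signs σ) ^ 2 = p at *
    generalize ∑ σ, evalML c₁ (signs σ) ^ 2 = q at *
    generalize ∑ σ, evalML c₀ (signs σ) ^ 2 * evalML c₁ (signs σ) ^ 2 = R at *
    have hN : (0 : ℝ) < 2 ^ n := by positivity
    have h9 : (0 : ℝ) < 9 ^ d := by positivity
    rw [pow_succ] at IH₀ ⊢
    generalize (2 : ℝ) ^ n = N at *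
    generalize (9 : ℝ) ^ d = K at *
    have hR : N * R ≤ 3 * K * p * q := by
      refine abs_le_of_sq_le_sq' ?_ (by positivity) |>.2
      calc (N * R) ^ 2 = N ^ 2 * R ^ 2 := by ring
        _ ≤ N ^ 2 * (P * Q) := by gcongr
        _ = (N * P) * (N * Q) := by ring
        _ ≤ (K * 9 * p ^ 2) * (K * q ^ 2) := by gcongr
        _ = (3 * K * p * q) ^ 2 := by ring
    nlinarith [mul_nonneg h9.le (sq_nonneg q)]

/-- The Bonami lemma in terms of the coefficients. -/
lemma sum_evalML_pow_four_le {n d : ℕ} {c : Finset (Fin n) → ℝ} (hc : ∀ S, d < S.card → c S = 0) :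
    ∑ σ, evalML c (signs σ) ^ 4 ≤ 2 ^ n * (9 ^ d * (∑ S, c S ^ 2) ^ 2) := by
  have h := bonami univ d c hc fun S hS => absurd (subset_univ S) hS
  rw [sum_evalML_sq] at h
  have hN : (0 : ℝ) < 2 ^ n := by positivity
  refine le_of_mul_le_mul_left (h.trans_eq ?_) hN
  ring

lemma sum_mulML_self_sq_le {n d : ℕ} {c : Finset (Fin n) → ℝ} (hc : ∀ S, d < S.card → c S = 0) :
    ∑ S, mulML c c S ^ 2 ≤ 9 ^ d * (∑ S, c S ^ 2) ^ 2 := by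
  have h := sum_evalML_pow_four_le hc
  have hP := sum_evalML_sq (mulML c c)
  simp_rw [evalML_mulML] at hP
  have hN : (0 : ℝ) < 2 ^ n := by positivity
  refine le_of_mul_le_mul_left ?_ hN
  rw [← hP]
  refine le_trans (le_of_eq (sum_congr rfl fun σ _ => ?_)) h
  ring

/-! ### Low-degree Fourier mass of the bisection distribution -/

lemma sq_coeff_one_sub_X_sq_pow_le (p m : ℕ) :
    (((1 - Polynomial.X ^ 2 : Polynomial ℝ) ^ p).coeff m) ^ 2 ≤ (p + p).choose m := by
  have h : (1 - Polynomial.X ^ 2 : Polynomial ℝ) ^ p =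
      Polynomial.C ((-1) ^ p) * Polynomial.expand ℝ 2 ((Polynomial.X + Polynomial.C (-1)) ^ p) := by
    simp only [map_pow, map_add, Polynomial.expand_X, Polynomial.expand_C, ← mul_pow]
    congr 1
    simp only [Polynomial.C_neg, Polynomial.C_1]
    ring
  rw [h, Polynomial.coeff_C_mul, Polynomial.coeff_expand two_pos, mul_pow, ← pow_mul, mul_comm p,
    pow_mul, neg_one_sq, one_pow, one_mul]
  split_ifs with hm
  · obtain ⟨k, rfl⟩ := hm
    rw [Nat.mul_div_cancel_left _ two_pos, Polynomial.coeff_X_add_C_pow, mul_pow, ← pow_mul,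
      mul_comm (p - k), pow_mul, neg_one_sq, one_pow, one_mul]
    have : p.choose k ^ 2 ≤ (p + p).choose (2 * k) := by
      rw [Nat.add_choose_eq, sq]
      exact single_le_sum (f := fun ij : ℕ × ℕ => p.choose ij.1 * p.choose ij.2)
        (fun _ _ => Nat.zero_le _) (a := (k, k)) (by simp [two_mul])
    exact_mod_cast this
  · simp

lemma sum_powersetCard_prod_eq_coeff {n : ℕ} (x : Fin n → ℝ) (m : ℕ) :
    ∑ S ∈ powersetCard m univ, ∏ i ∈ S, x i =
      (∏ i, (1 + Polynomial.C (x i) * Polynomial.X)).coeff m := by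
  rw [prod_one_add, Polynomial.finsetSum_coeff, powersetCard_eq_filter, sum_filter]
  refine sum_congr rfl fun S _ => ?_
  rw [prod_mul_distrib, prod_const, ← map_prod, Polynomial.coeff_C_mul_X_pow]
  simp only [eq_comm]

lemma exists_prod_one_add_signs {n : ℕ} {σ : Fin n → Bool} (hσ : σ ∈ bisSet n) :
    n = n / 2 + n / 2 ∧ ∏ i, (1 + Polynomial.C (signs σ i) * Polynomial.X) =
      (1 - Polynomial.X ^ 2 : Polynomial ℝ) ^ (n / 2) := by
  have h0 : intSum σ = 0 := (mem_filter.1 hσ).2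
  have hcard := card_filter_add_card_filter_not (s := (univ : Finset (Fin n))) (fun i => σ i = true)
  rw [intSum, sum_ite] at h0
  simp only [sum_const, nsmul_eq_mul, mul_one, mul_neg] at h0
  rw [card_univ, Fintype.card_fin] at hcard
  have h₁ : #{i | σ i = true} = n / 2 := by omega
  have h₂ : #{i | ¬ σ i = true} = n / 2 := by omega
  refine ⟨by omega, ?_⟩
  have h (i : Fin n) : (1 + Polynomial.C (signs σ i) * Polynomial.X : Polynomial ℝ) =
      if σ i = true then 1 + Polynomial.X else 1 - Polynomial.X := by
    unfold signs
    split_ifs <;> simp [sub_eq_add_neg]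
  simp_rw [h]
  rw [prod_ite, prod_const, prod_const, h₁, h₂, ← mul_pow]
  congr 1
  ring

lemma expOver_bisSet_prod_eq {n : ℕ} {S T : Finset (Fin n)} (h : S.card = T.card) :
    expOver (bisSet n) (fun σ => ∏ i ∈ S, signs σ i) =
      expOver (bisSet n) (fun σ => ∏ i ∈ T, signs σ i) := by
  classical
  obtain ⟨π, hπ⟩ : ∃ π : Equiv.Perm (Fin n), S.map π.toEmbedding = T := by
    let e : {x // x ∈ S} ≃ {x // x ∈ T} := equivOfCardEq h
    refine ⟨e.extendSubtype, eq_of_subset_of_card_le (fun y hy => ?_) (by simp [h])⟩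
    obtain ⟨x, hx, rfl⟩ := mem_map.1 hy
    exact e.extendSubtype_mem x hx
  unfold expOver
  congr 1
  refine sum_equiv (Equiv.arrowCongr π (Equiv.refl Bool)) (fun σ => ?_) fun σ _ => ?_
  · have : intSum (Equiv.arrowCongr π (Equiv.refl Bool) σ) = intSum σ :=
      Equiv.sum_comp π.symm fun i => if σ i then (1 : ℤ) else -1
    simp [bisSet, this]
  · rw [← hπ, prod_map]
    simp [signs]

lemma sum_powersetCard_expOver_sq_le (n m : ℕ) :
    ∑ S ∈ powersetCard m (univ : Finset (Fin n)),
      expOver (bisSet n) (fun σ => ∏ i ∈ S, signs σ i) ^ 2 ≤ 1 := by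
  rcases (bisSet n).eq_empty_or_nonempty with hD | ⟨τ, hτ⟩
  · simp [expOver, hD]
  rcases (powersetCard m (univ : Finset (Fin n))).eq_empty_or_nonempty with hm | ⟨T, hT⟩
  · simp [hm]
  have hconst : ∀ S ∈ powersetCard m (univ : Finset (Fin n)),
      expOver (bisSet n) (fun σ => ∏ i ∈ S, signs σ i) =
        expOver (bisSet n) (fun σ => ∏ i ∈ T, signs σ i) := fun S hS =>
    expOver_bisSet_prod_eq ((mem_powersetCard.1 hS).2.trans (mem_powersetCard.1 hT).2.symm)
  have hsum : ∑ S ∈ powersetCard m (univ : Finset (Fin n)),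
      expOver (bisSet n) (fun σ => ∏ i ∈ S, signs σ i) =
        ((1 - Polynomial.X ^ 2 : Polynomial ℝ) ^ (n / 2)).coeff m := by
    unfold expOver
    rw [← sum_div, sum_comm, sum_congr rfl fun σ hσ => by
      rw [sum_powersetCard_prod_eq_coeff, (exists_prod_one_add_signs hσ).2]]
    have : (0 : ℝ) < (bisSet n).card := by exact_mod_cast card_pos.2 ⟨τ, hτ⟩
    rw [sum_const, nsmul_eq_mul]
    field_simp
  have hle := sq_coeff_one_sub_X_sq_pow_le (n / 2) m
  rw [← (exists_prod_one_add_signs hτ).1, ← hsum, sum_congr rfl hconst] at hle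
  rw [sum_congr rfl fun S hS => by rw [hconst S hS]]
  have hpos : (0 : ℝ) < n.choose m := by
    have := card_pos.2 ⟨T, hT⟩
    rw [card_powersetCard, card_univ, Fintype.card_fin] at this
    exact_mod_cast this
  simp only [sum_const, card_powersetCard, card_univ, Fintype.card_fin, nsmul_eq_mul] at hle ⊢
  refine le_of_mul_le_mul_left ?_ hpos
  linarith

lemma sum_filter_card_le_expOver_sq_le (n k : ℕ) :
    ∑ S : Finset (Fin n) with S.card ≤ k,
      expOver (bisSet n) (fun σ => ∏ i ∈ S, signs σ i) ^ 2 ≤ k + 1 := by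
  rw [← sum_fiberwise_of_maps_to (g := card) (t := range (k + 1))
    (fun S hS => mem_range.2 (Nat.lt_succ_of_le (mem_filter.1 hS).2))]
  calc _ ≤ ∑ _m ∈ range (k + 1), (1 : ℝ) := by
        refine sum_le_sum fun m _ => le_trans ?_ (sum_powersetCard_expOver_sq_le n m)
        refine sum_le_sum_of_subset_of_nonneg (fun S hS => ?_) fun _ _ _ => sq_nonneg _
        exact mem_powersetCard.2 ⟨subset_univ S, (mem_filter.1 hS).2⟩
    _ = k + 1 := by simp

lemma expOver_evalML_sq_le {n k : ℕ} {c : Finset (Fin n) → ℝ} (hc : ∀ S, k < S.card → c S = 0) :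
    expOver (bisSet n) (fun σ => evalML c (signs σ)) ^ 2 ≤ (∑ S, c S ^ 2) * (k + 1) := by
  have h : expOver (bisSet n) (fun σ => evalML c (signs σ)) =
      ∑ S : Finset (Fin n) with S.card ≤ k,
        c S * expOver (bisSet n) (fun σ => ∏ i ∈ S, signs σ i) := by
    rw [sum_filter_of_ne fun S _ hS => not_lt.1 fun hk => hS (by rw [hc S hk, zero_mul])]
    unfold expOver evalML
    rw [sum_comm, sum_div]
    refine sum_congr rfl fun S _ => ?_
    rw [← mul_sum, mul_div_assoc]
  rw [h]
  refine (sum_mul_sq_le_sq_mul_sq _ _ _).trans ?_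
  gcongr
  · exact subset_univ _
  · exact sum_filter_card_le_expOver_sq_le n k

theorem stmt2 (d : ℕ) (hd : 1 ≤ d) :
    ∃ n₀ : ℕ, ∀ n : ℕ, n₀ ≤ n → Even n →
      ∀ c : Finset (Fin n) → ℝ, (∀ S, d < S.card → c S = 0) →
        expOver (bisSet n) (fun σ => (evalML c (signs σ)) ^ 4) ≤
          3 * (d : ℝ) * 9 ^ (2 * d) * (∑ S : Finset (Fin n), c S ^ 2) ^ 2 := by
  refine ⟨0, fun n _ _ c hc => ?_⟩
  have hc₂ : ∀ S, d + d < S.card → mulML c c S = 0 := mulML_eq_zero hc hc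
  have hE := expOver_evalML_sq_le (mulML_eq_zero hc₂ hc₂)
  have h₁ := sum_mulML_self_sq_le hc
  have h₂ := sum_mulML_self_sq_le hc₂
  have hev : (fun σ => evalML (mulML (mulML c c) (mulML c c)) (signs σ)) =
      fun σ => evalML c (signs σ) ^ 4 := by
    funext σ
    rw [evalML_mulML, evalML_mulML]
    ring
  rw [hev] at hE
  refine (abs_le_of_sq_le_sq' (hE.trans ?_) (by positivity)).2
  have hd' : (1 : ℝ) ≤ d := by exact_mod_cast hd
  calc _ ≤ 9 ^ (d + d) * (9 ^ d * (∑ S, c S ^ 2) ^ 2) ^ 2 * (9 * (d : ℝ) ^ 2) := by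
        gcongr
        · exact h₂.trans (by gcongr)
        · push_cast
          nlinarith
    _ = _ := by ring
end
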